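/- arXiv:2304.14778 — 11 statements merged into one kernel-verified Lean document; each statement's English description precedes it below -/
import Mathlib

section
/- Persistence: for every timed HT-trace M = (⟨H,T⟩,τ) of length λ over alphabet A, every metric formula φ over A, and every index 0 ≤ k < λ, if (⟨H,T⟩,τ),k ⊨ φ then (⟨T,T⟩,τ),k ⊨ φ. -/
/-- Metric formulas over an alphabet `A`.  Each temporal operator carries an
interval `[m, n)` with `m : ℕ` and `n : ℕ∞` (where `⊤` plays the role of `ω`). -/
inductive MForm (A : Type) : Type where
  | bot  : MForm A
  | atom : A → MForm A
  | conj : MForm A → MForm A → MForm A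
  | disj : MForm A → MForm A → MForm A
  | impl : MForm A → MForm A → MForm A
  | prev  : ℕ → ℕ∞ → MForm A → MForm A
  | since : ℕ → ℕ∞ → MForm A → MForm A → MForm A
  | trig  : ℕ → ℕ∞ → MForm A → MForm A → MForm A
  | next  : ℕ → ℕ∞ → MForm A → MForm A
  | untl  : ℕ → ℕ∞ → MForm A → MForm A → MForm A
  | rel   : ℕ → ℕ∞ → MForm A → MForm A → MForm A

/-- Membership of a duration `d` in the interval `[m, n)`. -/
def inIntv (m : ℕ) (n : ℕ∞) (d : ℕ) : Prop := m ≤ d ∧ (d : ℕ∞) < n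

/-- Satisfaction `(⟨H,T⟩,τ), k ⊨ φ` for a timed HT-trace of length `len`. -/
def sat {A : Type} : MForm A → (ℕ → Set A) → (ℕ → Set A) → (ℕ → ℕ) → ℕ∞ → ℕ → Prop
  | .bot, _, _, _, _, _ => False
  | .atom p, H, _, _, _, k => p ∈ H k
  | .conj φ ψ, H, T, τ, len, k => sat φ H T τ len k ∧ sat ψ H T τ len k
  | .disj φ ψ, H, T, τ, len, k => sat φ H T τ len k ∨ sat ψ H T τ len k
  | .impl φ ψ, H, T, τ, len, k =>
      (¬ sat φ H T τ len k ∨ sat ψ H T τ len k) ∧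
      (¬ sat φ T T τ len k ∨ sat ψ T T τ len k)
  | .prev m n φ, H, T, τ, len, k =>
      0 < k ∧ sat φ H T τ len (k-1) ∧ inIntv m n (τ k - τ (k-1))
  | .since m n φ ψ, H, T, τ, len, k =>
      ∃ j, j ≤ k ∧ inIntv m n (τ k - τ j) ∧ sat ψ H T τ len j ∧
        ∀ i, j < i → i ≤ k → sat φ H T τ len i
  | .trig m n φ ψ, H, T, τ, len, k =>
      ∀ j, j ≤ k → inIntv m n (τ k - τ j) →
        (sat ψ H T τ len j ∨ ∃ i, j < i ∧ i ≤ k ∧ sat φ H T τ len i)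
  | .next m n φ, H, T, τ, len, k =>
      (k : ℕ∞) + 1 < len ∧ sat φ H T τ len (k+1) ∧ inIntv m n (τ (k+1) - τ k)
  | .untl m n φ ψ, H, T, τ, len, k =>
      ∃ j, k ≤ j ∧ (j : ℕ∞) < len ∧ inIntv m n (τ j - τ k) ∧ sat ψ H T τ len j ∧
        ∀ i, k ≤ i → i < j → sat φ H T τ len i
  | .rel m n φ ψ, H, T, τ, len, k =>
      ∀ j, k ≤ j → (j : ℕ∞) < len → inIntv m n (τ j - τ k) →
        (sat ψ H T τ len j ∨ ∃ i, k ≤ i ∧ i < j ∧ sat φ H T τ len i)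

/-- `(⟨H,T⟩,τ)` is a timed HT-trace of length `len`. -/
def isTrace {A : Type} (H T : ℕ → Set A) (τ : ℕ → ℕ) (len : ℕ∞) : Prop :=
  (∀ i : ℕ, (i : ℕ∞) < len → H i ⊆ T i) ∧
  (∀ i : ℕ, (i : ℕ∞) + 1 < len → τ i ≤ τ (i+1)) ∧
  τ 0 = 0

/-- Strict timing. -/
def isStrict (τ : ℕ → ℕ) (len : ℕ∞) : Prop :=
  ∀ i : ℕ, (i : ℕ∞) + 1 < len → τ i < τ (i+1)

/-- Persistence (Proposition 3). -/
theorem persistence {A : Type} (H T : ℕ → Set A) (τ : ℕ → ℕ) (len : ℕ∞)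
    (htrace : isTrace H T τ len) (φ : MForm A) (k : ℕ) (hk : (k : ℕ∞) < len)
    (h : sat φ H T τ len k) : sat φ T T τ len k := by
  have lt_len {i j : ℕ} (hij : i ≤ j) (hj : (j : ℕ∞) < len) : (i : ℕ∞) < len :=
    (Nat.cast_le.mpr hij).trans_lt hj
  induction φ generalizing k with
  | bot => exact h
  | atom p => exact htrace.1 k hk h
  | conj φ ψ ihφ ihψ => exact ⟨ihφ k hk h.1, ihψ k hk h.2⟩
  | disj φ ψ ihφ ihψ => exact h.imp (ihφ k hk) (ihψ k hk)
  | impl φ ψ => exact ⟨h.2, h.2⟩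
  | prev m n φ ih => exact ⟨h.1, ih _ (lt_len (Nat.sub_le k 1) hk) h.2.1, h.2.2⟩
  | since m n φ ψ ihφ ihψ =>
    obtain ⟨j, hjk, hI, hψ, hφ⟩ := h
    exact ⟨j, hjk, hI, ihψ j (lt_len hjk hk) hψ,
      fun i hji hik => ihφ i (lt_len hik hk) (hφ i hji hik)⟩
  | trig m n φ ψ ihφ ihψ =>
    intro j hjk hI
    exact (h j hjk hI).imp (ihψ j (lt_len hjk hk))
      fun ⟨i, hji, hik, hφ⟩ => ⟨i, hji, hik, ihφ i (lt_len hik hk) hφ⟩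
  | next m n φ ih => exact ⟨h.1, ih _ (by exact_mod_cast h.1) h.2.1, h.2.2⟩
  | untl m n φ ψ ihφ ihψ =>
    obtain ⟨j, hkj, hj, hI, hψ, hφ⟩ := h
    exact ⟨j, hkj, hj, hI, ihψ j hj hψ,
      fun i hki hij => ihφ i (lt_len hij.le hj) (hφ i hki hij)⟩
  | rel m n φ ψ ihφ ihψ =>
    intro j hkj hj hI
    exact (h j hkj hj hI).imp (ihψ j hj)
      fun ⟨i, hki, hij, hφ⟩ => ⟨i, hki, hij, ihφ i (lt_len hij.le hj) hφ⟩
end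

section
/- Satisfaction of temporal formulas is independent of the timing function: if φ is a metric formula over A in which every temporal operator carries the interval [0,ω), then for every HT-trace ⟨H,T⟩ of length λ, any two admissible timing functions τ and τ' (nondecreasing [0,λ) → ℕ with value 0 at 0), and every 0 ≤ k < λ, (⟨H,T⟩,τ),k ⊨ φ if and only if (⟨H,T⟩,τ'),k ⊨ φ. -/
/-- A metric formula is temporal if every modal operator carries the interval `[0, ω)`. -/
def isTemporal {A : Type} : MForm A → Prop
  | .bot => True
  | .atom _ => True
  | .conj φ ψ => isTemporal φ ∧ isTemporal ψ
  | .disj φ ψ => isTemporal φ ∧ isTemporal ψ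
  | .impl φ ψ => isTemporal φ ∧ isTemporal ψ
  | .prev m n φ => m = 0 ∧ n = ⊤ ∧ isTemporal φ
  | .next m n φ => m = 0 ∧ n = ⊤ ∧ isTemporal φ
  | .since m n φ ψ => m = 0 ∧ n = ⊤ ∧ isTemporal φ ∧ isTemporal ψ
  | .trig m n φ ψ => m = 0 ∧ n = ⊤ ∧ isTemporal φ ∧ isTemporal ψ
  | .untl m n φ ψ => m = 0 ∧ n = ⊤ ∧ isTemporal φ ∧ isTemporal ψ
  | .rel m n φ ψ => m = 0 ∧ n = ⊤ ∧ isTemporal φ ∧ isTemporal ψ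

theorem inIntv_zero_top (d : ℕ) : inIntv 0 ⊤ d :=
  ⟨d.zero_le, ENat.natCast_lt_top d⟩

/-- With every interval equal to `[0, ω)`, the timing constraints hold for arbitrary functions
`τ` and at every position, inside the trace or not. -/
theorem sat_iff_sat_of_isTemporal {A : Type} (φ : MForm A) (hφ : isTemporal φ)
    (H T : ℕ → Set A) (len : ℕ∞) (τ τ' : ℕ → ℕ) (k : ℕ) :
    sat φ H T τ len k ↔ sat φ H T τ' len k := by
  induction φ generalizing H k with
  | bot | atom => rfl
  | conj φ ψ ihφ ihψ | disj φ ψ ihφ ihψ | impl φ ψ ihφ ihψ =>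
    simp only [sat, ihφ hφ.1, ihψ hφ.2]
  | prev m n φ ih | next m n φ ih =>
    obtain ⟨rfl, rfl, hφ⟩ := hφ
    simp only [sat, inIntv_zero_top, ih hφ]
  | since m n φ ψ ihφ ihψ | trig m n φ ψ ihφ ihψ | untl m n φ ψ ihφ ihψ | rel m n φ ψ ihφ ihψ =>
    obtain ⟨rfl, rfl, hφ, hψ⟩ := hφ
    simp only [sat, inIntv_zero_top, ihφ hφ, ihψ hψ]

/-- Satisfaction of temporal formulas does not depend on the timing function
(Proposition 2). -/
theorem temporal_timing_irrelevant {A : Type} (φ : MForm A) (hφ : isTemporal φ)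
    (H T : ℕ → Set A) (len : ℕ∞)
    (hsub : ∀ i : ℕ, (i : ℕ∞) < len → H i ⊆ T i)
    (τ τ' : ℕ → ℕ)
    (hτmono : ∀ i : ℕ, (i : ℕ∞) + 1 < len → τ i ≤ τ (i+1)) (hτ0 : τ 0 = 0)
    (hτ'mono : ∀ i : ℕ, (i : ℕ∞) + 1 < len → τ' i ≤ τ' (i+1)) (hτ'0 : τ' 0 = 0)
    (k : ℕ) (hk : (k : ℕ∞) < len) :
    sat φ H T τ len k ↔ sat φ H T τ' len k :=
  sat_iff_sat_of_isTemporal φ hφ H T len τ τ' k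
end

section
/- MTL models coincide with MHT models extended by temporal excluded middle: for any set Γ of metric formulas over A and any timed HT-trace (⟨H,T⟩,τ) of length λ ≥ 1, (⟨H,T⟩,τ),0 ⊨ γ for every γ ∈ Γ ∪ EM(A) if and only if H_i = T_i for all 0 ≤ i < λ and (⟨T,T⟩,τ),0 ⊨ γ for every γ ∈ Γ, where EM(A) := { ◻_{[0,ω)}(p ∨ ¬p) : p ∈ A }. -/
/-- Negation `¬φ := φ → ⊥`. -/
def mNeg {A : Type} (φ : MForm A) : MForm A := MForm.impl φ MForm.bot

/-- `⊤ := ¬⊥`. -/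
def mTop {A : Type} : MForm A := mNeg MForm.bot

/-- Eventually `◇_I φ := ⊤ U_I φ`. -/
def mEvent {A : Type} (m : ℕ) (n : ℕ∞) (φ : MForm A) : MForm A := MForm.untl m n mTop φ

/-- Always `◻_I φ := ⊥ R_I φ`. -/
def mAlways {A : Type} (m : ℕ) (n : ℕ∞) (φ : MForm A) : MForm A := MForm.rel m n MForm.bot φ

/-- Eventually-before `◆_I φ := ⊤ S_I φ`. -/
def mEvB {A : Type} (m : ℕ) (n : ℕ∞) (φ : MForm A) : MForm A := MForm.since m n mTop φ

/-- Always-before `■_I φ := ⊥ T_I φ`. -/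
def mAlwB {A : Type} (m : ℕ) (n : ℕ∞) (φ : MForm A) : MForm A := MForm.trig m n MForm.bot φ

/-- Weak next `○̂_I φ := ○_I φ ∨ ¬○_I ⊤`. -/
def mWNext {A : Type} (m : ℕ) (n : ℕ∞) (φ : MForm A) : MForm A :=
  MForm.disj (MForm.next m n φ) (mNeg (MForm.next m n mTop))

/-- Weak previous `•̂_I φ := •_I φ ∨ ¬•_I ⊤`. -/
def mWPrev {A : Type} (m : ℕ) (n : ℕ∞) (φ : MForm A) : MForm A :=
  MForm.disj (MForm.prev m n φ) (mNeg (MForm.prev m n mTop))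

/-- The temporal excluded middle axioms `EM(A)`. -/
def EMset (A : Type) : Set (MForm A) :=
  {γ | ∃ p : A, γ = mAlways 0 ⊤ (MForm.disj (MForm.atom p) (mNeg (MForm.atom p)))}

/-- On a trace whose components agree, satisfaction is satisfaction in the total trace. -/
theorem sat_iff_sat_total {A : Type} {H T : ℕ → Set A} {τ : ℕ → ℕ} {len : ℕ∞}
    (h : ∀ i : ℕ, (i : ℕ∞) < len → H i = T i) (φ : MForm A) {k : ℕ} (hk : (k : ℕ∞) < len) :
    sat φ H T τ len k ↔ sat φ T T τ len k := by
  have lt_of_le {i j : ℕ} (hij : i ≤ j) (hj : (j : ℕ∞) < len) : (i : ℕ∞) < len :=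
    (Nat.cast_le.mpr hij).trans_lt hj
  induction φ generalizing k with
  | bot => rfl
  | atom p => simp only [sat, h k hk]
  | conj φ ψ ihφ ihψ => simp only [sat, ihφ hk, ihψ hk]
  | disj φ ψ ihφ ihψ => simp only [sat, ihφ hk, ihψ hk]
  | impl φ ψ ihφ ihψ => simp only [sat, ihφ hk, ihψ hk]
  | prev m n φ ih => simp only [sat, ih (lt_of_le (Nat.sub_le k 1) hk)]
  | since m n φ ψ ihφ ihψ =>
    refine exists_congr fun j => and_congr_right fun hj => and_congr_right fun _ =>
      and_congr (ihψ (lt_of_le hj hk)) ?_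
    exact forall_congr' fun i => forall_congr' fun _ => forall_congr' fun hi =>
      ihφ (lt_of_le hi hk)
  | trig m n φ ψ ihφ ihψ =>
    refine forall_congr' fun j => forall_congr' fun hj => forall_congr' fun _ =>
      or_congr (ihψ (lt_of_le hj hk)) ?_
    exact exists_congr fun i => and_congr_right fun _ => and_congr_right fun hi =>
      ihφ (lt_of_le hi hk)
  | next m n φ ih =>
    refine and_congr_right fun hlt => and_congr_left fun _ => ih ?_
    exact_mod_cast hlt
  | untl m n φ ψ ihφ ihψ =>
    refine exists_congr fun j => and_congr_right fun _ => and_congr_right fun hj =>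
      and_congr_right fun _ => and_congr (ihψ hj) ?_
    exact forall_congr' fun i => forall_congr' fun _ => forall_congr' fun hi =>
      ihφ (lt_of_le hi.le hj)
  | rel m n φ ψ ihφ ihψ =>
    refine forall_congr' fun j => forall_congr' fun _ => forall_congr' fun hj =>
      forall_congr' fun _ => or_congr (ihψ hj) ?_
    exact exists_congr fun i => and_congr_right fun _ => and_congr_right fun hi =>
      ihφ (lt_of_le hi.le hj)

/-- The temporal excluded middle axioms hold at the origin exactly on total traces. -/
theorem forall_sat_EMset_iff {A : Type} {H T : ℕ → Set A} {τ : ℕ → ℕ} {len : ℕ∞}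
    (hHT : ∀ i : ℕ, (i : ℕ∞) < len → H i ⊆ T i) :
    (∀ γ ∈ EMset A, sat γ H T τ len 0) ↔ ∀ i : ℕ, (i : ℕ∞) < len → H i = T i := by
  constructor
  · intro hEM i hi
    refine (hHT i hi).antisymm fun p hpT => ?_
    have hp := hEM _ ⟨p, rfl⟩ i (Nat.zero_le i) hi
      ⟨Nat.zero_le _, ENat.natCast_lt_top _⟩
    simpa [sat, mNeg, hpT] using hp
  · rintro h γ ⟨p, rfl⟩ j - hj -
    simp [sat, mNeg, h j hj, em]

/-- MTL models of `Γ` coincide with MHT models of `Γ ∪ EM(A)` (Corollary 2). -/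
theorem mtl_models_are_mht_em_models {A : Type} (Γ : Set (MForm A))
    (H T : ℕ → Set A) (τ : ℕ → ℕ) (len : ℕ∞)
    (htrace : isTrace H T τ len) (hlen : 1 ≤ len) :
    (∀ γ ∈ Γ ∪ EMset A, sat γ H T τ len 0) ↔
      ((∀ i : ℕ, (i : ℕ∞) < len → H i = T i) ∧ ∀ γ ∈ Γ, sat γ T T τ len 0) := by
  have h0 : ((0 : ℕ) : ℕ∞) < len := by
    simpa using zero_lt_one.trans_le hlen
  have hsplit : (∀ γ ∈ Γ ∪ EMset A, sat γ H T τ len 0) ↔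
      (∀ γ ∈ EMset A, sat γ H T τ len 0) ∧ ∀ γ ∈ Γ, sat γ H T τ len 0 := by
    simp only [Set.mem_union, or_imp, forall_and, and_comm]
  rw [hsplit, forall_sat_EMset_iff htrace.1]
  exact and_congr_right fun h => forall₂_congr fun γ _ => sat_iff_sat_total h γ h0
end

section
/- For implication-free formulas, equivalence on total traces suffices: let φ and ψ be metric formulas over A containing no occurrence of the connective →. Then φ ≡ ψ in MHT (i.e., M,k ⊨ φ iff M,k ⊨ ψ for every timed HT-trace M of any length λ and every 0 ≤ k < λ) if and only if M,k ⊨ φ iff M,k ⊨ ψ for every total timed HT-trace M and every 0 ≤ k < λ. -/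
/-- Implication-free metric formulas. -/
def impFree {A : Type} : MForm A → Prop
  | .bot => True
  | .atom _ => True
  | .conj φ ψ => impFree φ ∧ impFree ψ
  | .disj φ ψ => impFree φ ∧ impFree ψ
  | .impl _ _ => False
  | .prev _ _ φ => impFree φ
  | .next _ _ φ => impFree φ
  | .since _ _ φ ψ => impFree φ ∧ impFree ψ
  | .trig _ _ φ ψ => impFree φ ∧ impFree ψ
  | .untl _ _ φ ψ => impFree φ ∧ impFree ψ
  | .rel _ _ φ ψ => impFree φ ∧ impFree ψ

/-- Satisfaction of an implication-free formula does not depend on the there component. -/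
theorem sat_iff_sat_self_of_impFree {A : Type} (φ : MForm A) (hφ : impFree φ)
    (H T : ℕ → Set A) (τ : ℕ → ℕ) (len : ℕ∞) (k : ℕ) :
    sat φ H T τ len k ↔ sat φ H H τ len k := by
  induction φ generalizing k with
  | bot | atom => rfl
  | impl => exact hφ.elim
  | prev m n φ ih | next m n φ ih => simp only [sat, ih hφ]
  | conj φ ψ ihφ ihψ | disj φ ψ ihφ ihψ => simp only [sat, ihφ hφ.1, ihψ hφ.2]
  | since m n φ ψ ihφ ihψ | trig m n φ ψ ihφ ihψ | untl m n φ ψ ihφ ihψ | rel m n φ ψ ihφ ihψ =>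
    simp only [sat, ihφ hφ.1, ihψ hφ.2]

/-- For implication-free formulas, MHT-equivalence coincides with equivalence on
total traces (Proposition 5). -/
theorem impfree_total_equiv {A : Type} (φ ψ : MForm A)
    (hφ : impFree φ) (hψ : impFree ψ) :
    (∀ (H T : ℕ → Set A) (τ : ℕ → ℕ) (len : ℕ∞), isTrace H T τ len →
        ∀ k : ℕ, (k : ℕ∞) < len → (sat φ H T τ len k ↔ sat ψ H T τ len k)) ↔
    (∀ (T : ℕ → Set A) (τ : ℕ → ℕ) (len : ℕ∞), isTrace T T τ len →
        ∀ k : ℕ, (k : ℕ∞) < len → (sat φ T T τ len k ↔ sat ψ T T τ len k)) := by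
  refine ⟨fun h T => h T T, fun h H T τ len hM k hk => ?_⟩
  rw [sat_iff_sat_self_of_impFree φ hφ H T, sat_iff_sat_self_of_impFree ψ hψ H T]
  exact h H τ len ⟨fun _ _ => subset_rfl, hM.2⟩ k hk
end

section
/- Trace-reversal lemma: let M = (⟨H,T⟩,τ) be a timed HT-trace of finite length λ ≥ 1 over A, and define the reversed trace ρ(M) = (⟨H',T'⟩,τ') of length λ by H'_i := H_{λ−1−i}, T'_i := T_{λ−1−i}, and τ'(i) := τ(λ−1) − τ(λ−1−i) for 0 ≤ i < λ. Let σ be the syntactic map on metric formulas that fixes ⊥ and atoms, commutes with ∧, ∨, →, and swaps each future operator with its past counterpart preserving the interval: σ(φ U_I ψ) = σ(φ) S_I σ(ψ), σ(φ S_I ψ) = σ(φ) U_I σ(ψ), σ(φ R_I ψ) = σ(φ) T_I σ(ψ), σ(φ T_I ψ) = σ(φ) R_I σ(ψ), σ(○_I φ) = •_I σ(φ), σ(•_I φ) = ○_I σ(φ). Then for every metric formula φ and every 0 ≤ k < λ: M,k ⊨ φ if and only if ρ(M), λ−1−k ⊨ σ(φ). -/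
/-- The syntactic future/past swap `σ`. -/
def sigmaMap {A : Type} : MForm A → MForm A
  | .bot => .bot
  | .atom p => .atom p
  | .conj φ ψ => .conj (sigmaMap φ) (sigmaMap ψ)
  | .disj φ ψ => .disj (sigmaMap φ) (sigmaMap ψ)
  | .impl φ ψ => .impl (sigmaMap φ) (sigmaMap ψ)
  | .prev m n φ => .next m n (sigmaMap φ)
  | .next m n φ => .prev m n (sigmaMap φ)
  | .since m n φ ψ => .untl m n (sigmaMap φ) (sigmaMap ψ)
  | .untl m n φ ψ => .since m n (sigmaMap φ) (sigmaMap ψ)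
  | .trig m n φ ψ => .rel m n (sigmaMap φ) (sigmaMap ψ)
  | .rel m n φ ψ => .trig m n (sigmaMap φ) (sigmaMap ψ)

/-- Reversing positions turns a past quantification pattern into the future one. -/
theorem since_iff_untl_reverse {lam : ℕ} {τ τ' : ℕ → ℕ} {P Q P' Q' : ℕ → Prop}
    (hτ : ∀ a b, a ≤ b → b < lam → τ' (lam - 1 - a) - τ' (lam - 1 - b) = τ b - τ a)
    (hP : ∀ i, i < lam → (P i ↔ P' (lam - 1 - i)))
    (hQ : ∀ i, i < lam → (Q i ↔ Q' (lam - 1 - i)))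
    (m : ℕ) (n : ℕ∞) {k : ℕ} (hk : k < lam) :
    (∃ j, j ≤ k ∧ inIntv m n (τ k - τ j) ∧ Q j ∧ ∀ i, j < i → i ≤ k → P i) ↔
      ∃ j, lam - 1 - k ≤ j ∧ (j : ℕ∞) < lam ∧ inIntv m n (τ' j - τ' (lam - 1 - k)) ∧ Q' j ∧
        ∀ i, lam - 1 - k ≤ i → i < j → P' i := by
  constructor
  · rintro ⟨j, hjk, hI, hQj, hPi⟩
    refine ⟨lam - 1 - j, by omega, by norm_cast; omega, by rwa [hτ j k hjk hk],
      (hQ j (by omega)).1 hQj, fun i hi hij => ?_⟩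
    have := (hP (lam - 1 - i) (by omega)).1 (hPi _ (by omega) (by omega))
    rwa [Nat.sub_sub_self (by omega)] at this
  · rintro ⟨j, hkj, hj, hI, hQj, hPi⟩
    norm_cast at hj
    have hjj : lam - 1 - (lam - 1 - j) = j := by omega
    refine ⟨lam - 1 - j, by omega, ?_, (hQ _ (by omega)).2 (by rwa [hjj]), fun i hi hik =>
      (hP i (by omega)).2 (hPi _ (by omega) (by omega))⟩
    rwa [← hτ _ k (by omega) hk, hjj]

/-- Reversing positions turns a future quantification pattern into the past one. -/
theorem untl_iff_since_reverse {lam : ℕ} {τ τ' : ℕ → ℕ} {P Q P' Q' : ℕ → Prop}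
    (hτ : ∀ a b, a ≤ b → b < lam → τ' (lam - 1 - a) - τ' (lam - 1 - b) = τ b - τ a)
    (hP : ∀ i, i < lam → (P i ↔ P' (lam - 1 - i)))
    (hQ : ∀ i, i < lam → (Q i ↔ Q' (lam - 1 - i)))
    (m : ℕ) (n : ℕ∞) {k : ℕ} (hk : k < lam) :
    (∃ j, k ≤ j ∧ (j : ℕ∞) < lam ∧ inIntv m n (τ j - τ k) ∧ Q j ∧
        ∀ i, k ≤ i → i < j → P i) ↔
      ∃ j, j ≤ lam - 1 - k ∧ inIntv m n (τ' (lam - 1 - k) - τ' j) ∧ Q' j ∧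
        ∀ i, j < i → i ≤ lam - 1 - k → P' i := by
  have hinv : ∀ i, i < lam → lam - 1 - (lam - 1 - i) = i := fun i hi => by omega
  have h := since_iff_untl_reverse (τ := τ') (τ' := τ) (P := P') (Q := Q') (P' := P) (Q' := Q)
    (fun a b hab hb => by
      rw [← hτ (lam - 1 - b) (lam - 1 - a) (by omega) (by omega), hinv a (by omega), hinv b hb])
    (fun i hi => by rw [hP _ (by omega), hinv i hi])
    (fun i hi => by rw [hQ _ (by omega), hinv i hi]) m n
    (k := lam - 1 - k) (by omega)
  rw [hinv k hk] at h
  exact h.symm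

/-- Trace reversal for an arbitrary pair of time functions with mirrored durations. -/
theorem sat_iff_sat_sigmaMap_reverse {A : Type} {lam : ℕ} {τ τ' : ℕ → ℕ}
    (hτ : ∀ a b, a ≤ b → b < lam → τ' (lam - 1 - a) - τ' (lam - 1 - b) = τ b - τ a)
    {T T' : ℕ → Set A} (hT : ∀ i, i < lam → T' (lam - 1 - i) = T i) (φ : MForm A) :
    ∀ {H H' : ℕ → Set A}, (∀ i, i < lam → H' (lam - 1 - i) = H i) → ∀ k, k < lam →
      (sat φ H T τ lam k ↔ sat (sigmaMap φ) H' T' τ' lam (lam - 1 - k)) := by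
  induction φ with
  | bot => intros; rfl
  | atom p => intro H H' hH k hk; simp only [sat, sigmaMap, hH k hk]
  | conj φ ψ ihφ ihψ =>
    intro H H' hH k hk
    simp only [sat, sigmaMap, ihφ hH k hk, ihψ hH k hk]
  | disj φ ψ ihφ ihψ =>
    intro H H' hH k hk
    simp only [sat, sigmaMap, ihφ hH k hk, ihψ hH k hk]
  | impl φ ψ ihφ ihψ =>
    intro H H' hH k hk
    simp only [sat, sigmaMap, ihφ hH k hk, ihψ hH k hk, ihφ hT k hk, ihψ hT k hk]
  | prev m n φ ih =>
    intro H H' hH k hk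
    simp only [sat, sigmaMap]
    norm_cast
    rcases Nat.eq_zero_or_pos k with rfl | h
    · simp only [lt_irrefl, false_and, false_iff, not_and]
      omega
    · rw [ih hH (k - 1) (by omega), ← hτ (k - 1) k (by omega) hk,
        show lam - 1 - k + 1 = lam - 1 - (k - 1) by omega]
      exact and_congr_left fun _ => by omega
  | next m n φ ih =>
    intro H H' hH k hk
    simp only [sat, sigmaMap]
    norm_cast
    by_cases h : k + 1 < lam
    · rw [ih hH (k + 1) h, ← hτ k (k + 1) (by omega) h,
        show lam - 1 - k - 1 = lam - 1 - (k + 1) by omega]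
      exact and_congr_left fun _ => by omega
    · exact iff_of_false (fun h' => h h'.1) fun h' => h (by omega)
  | since m n φ ψ ihφ ihψ =>
    intro H H' hH k hk
    exact since_iff_untl_reverse hτ (ihφ hH) (ihψ hH) m n hk
  | untl m n φ ψ ihφ ihψ =>
    intro H H' hH k hk
    exact untl_iff_since_reverse hτ (ihφ hH) (ihψ hH) m n hk
  | trig m n φ ψ ihφ ihψ =>
    intro H H' hH k hk
    have h := since_iff_untl_reverse hτ
      (P := fun i => ¬ sat φ H T τ lam i) (P' := fun i => ¬ sat (sigmaMap φ) H' T' τ' lam i)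
      (Q := fun i => ¬ sat ψ H T τ lam i) (Q' := fun i => ¬ sat (sigmaMap ψ) H' T' τ' lam i)
      (fun i hi => not_congr (ihφ hH i hi))
      (fun i hi => not_congr (ihψ hH i hi)) m n hk
    rw [← not_iff_not]
    simp only [sat, sigmaMap]
    push Not
    exact h
  | rel m n φ ψ ihφ ihψ =>
    intro H H' hH k hk
    have h := untl_iff_since_reverse hτ
      (P := fun i => ¬ sat φ H T τ lam i) (P' := fun i => ¬ sat (sigmaMap φ) H' T' τ' lam i)
      (Q := fun i => ¬ sat ψ H T τ lam i) (Q' := fun i => ¬ sat (sigmaMap ψ) H' T' τ' lam i)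
      (fun i hi => not_congr (ihφ hH i hi))
      (fun i hi => not_congr (ihψ hH i hi)) m n hk
    rw [← not_iff_not]
    simp only [sat, sigmaMap]
    push Not
    exact h

/-- Trace-reversal lemma (Lemma 1). -/
theorem trace_reversal {A : Type} (lam : ℕ) (hlam : 1 ≤ lam)
    (H T : ℕ → Set A) (τ : ℕ → ℕ) (htrace : isTrace H T τ (lam : ℕ∞))
    (H' T' : ℕ → Set A) (τ' : ℕ → ℕ)
    (hH' : ∀ i : ℕ, H' i = H (lam - 1 - i))
    (hT' : ∀ i : ℕ, T' i = T (lam - 1 - i))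
    (hτ' : ∀ i : ℕ, τ' i = τ (lam - 1) - τ (lam - 1 - i))
    (φ : MForm A) (k : ℕ) (hk : k < lam) :
    sat φ H T τ (lam : ℕ∞) k ↔
      sat (sigmaMap φ) H' T' τ' (lam : ℕ∞) (lam - 1 - k) := by
  have hinv : ∀ i, i < lam → lam - 1 - (lam - 1 - i) = i := fun i hi => by omega
  have hmono : ∀ a b, a ≤ b → b < lam → τ a ≤ τ b := by
    intro a b hab
    induction b, hab using Nat.le_induction with
    | base => exact fun _ => le_rfl
    | succ b _ ih =>
      exact fun hb => (ih (by omega)).trans (htrace.2.1 b (by exact_mod_cast hb))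
  refine sat_iff_sat_sigmaMap_reverse (fun a b hab hb => ?_)
    (fun i hi => by rw [hT', hinv i hi]) φ (fun i hi => by rw [hH', hinv i hi]) k hk
  rw [hτ', hτ', hinv a (by omega), hinv b hb]
  have := hmono a b hab hb
  have := hmono b (lam - 1) (by omega) (by omega)
  omega
end

section
/- Temporal duality: a metric formula φ over A is a tautology over finite timed HT-traces (i.e., M,k ⊨ φ for every timed HT-trace M of every finite length λ and every 0 ≤ k < λ) if and only if σ(φ) is a tautology over finite timed HT-traces, where σ is the syntactic map that fixes ⊥ and atoms, commutes with ∧, ∨, →, and swaps each future operator with its past counterpart preserving the interval: σ(φ U_I ψ) = σ(φ) S_I σ(ψ), σ(φ S_I ψ) = σ(φ) U_I σ(ψ), σ(φ R_I ψ) = σ(φ) T_I σ(ψ), σ(φ T_I ψ) = σ(φ) R_I σ(ψ), σ(○_I φ) = •_I σ(φ), σ(•_I φ) = ○_I σ(φ). -/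
/-- Tautology over finite timed HT-traces. -/
def finTaut {A : Type} (φ : MForm A) : Prop :=
  ∀ (lam : ℕ) (H T : ℕ → Set A) (τ : ℕ → ℕ), isTrace H T τ (lam : ℕ∞) →
    ∀ k : ℕ, k < lam → sat φ H T τ (lam : ℕ∞) k

theorem sigmaMap_sigmaMap {A : Type} (φ : MForm A) : sigmaMap (sigmaMap φ) = φ := by
  induction φ <;> simp_all [sigmaMap]

/-- Two traces of length `N + 1` that mirror each other (positions `i` and `i'` with `i + i' = N`
carry the same atoms, and durations agree) satisfy, at mirrored positions, a formula and its
future/past swap respectively. -/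
theorem sat_iff_sat_sigmaMap {A : Type} {N : ℕ} {τ τ' : ℕ → ℕ}
    (hτ : ∀ i i' j j', i + i' = N → j + j' = N → i ≤ j → τ j - τ i = τ' i' - τ' j')
    (φ : MForm A) {H H' T T' : ℕ → Set A} (hH : ∀ i i', i + i' = N → H i = H' i')
    (hT : ∀ i i', i + i' = N → T i = T' i') {k k' : ℕ} (hk : k + k' = N) :
    sat φ H T τ ((N + 1 : ℕ) : ℕ∞) k ↔ sat (sigmaMap φ) H' T' τ' ((N + 1 : ℕ) : ℕ∞) k' := by
  induction φ generalizing H H' k k' with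
  | bot => rfl
  | atom p => simp only [sat, sigmaMap, hH k k' hk]
  | conj φ ψ ihφ ihψ => simp only [sat, sigmaMap, ihφ hH hk, ihψ hH hk]
  | disj φ ψ ihφ ihψ => simp only [sat, sigmaMap, ihφ hH hk, ihψ hH hk]
  | impl φ ψ ihφ ihψ =>
    simp only [sat, sigmaMap, ihφ hH hk, ihψ hH hk, ihφ hT hk, ihψ hT hk]
  | prev m n φ ih =>
    have hlt : (k' : ℕ∞) + 1 < ((N + 1 : ℕ) : ℕ∞) ↔ 0 < k := by
      norm_cast; omega
    simp only [sat, sigmaMap, hlt]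
    refine and_congr_right fun h => ?_
    rw [ih hH (show k - 1 + (k' + 1) = N by omega),
      hτ (k - 1) (k' + 1) k k' (by omega) hk (by omega)]
  | next m n φ ih =>
    have hlt : (k : ℕ∞) + 1 < ((N + 1 : ℕ) : ℕ∞) ↔ 0 < k' := by
      norm_cast; omega
    simp only [sat, sigmaMap, hlt]
    refine and_congr_right fun h => ?_
    rw [ih hH (show k + 1 + (k' - 1) = N by omega),
      hτ k k' (k + 1) (k' - 1) hk (by omega) (by omega)]
  | since m n φ ψ ihφ ihψ =>
    simp only [sat, sigmaMap, Nat.cast_lt]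
    constructor
    · rintro ⟨j, hj, hI, hψ, hφ⟩
      refine ⟨N - j, by omega, by omega, ?_, (ihψ hH (by omega)).1 hψ, fun i hi hij => ?_⟩
      · rwa [← hτ j (N - j) k k' (by omega) hk hj]
      · exact (ihφ hH (show N - i + i = N by omega)).1 (hφ _ (by omega) (by omega))
    · rintro ⟨j, hj, hjN, hI, hψ, hφ⟩
      refine ⟨N - j, by omega, ?_, (ihψ hH (by omega)).2 hψ, fun i hi hij => ?_⟩
      · rwa [hτ (N - j) j k k' (by omega) hk (by omega)]
      · exact (ihφ hH (show i + (N - i) = N by omega)).2 (hφ _ (by omega) (by omega))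
  | untl m n φ ψ ihφ ihψ =>
    simp only [sat, sigmaMap, Nat.cast_lt]
    constructor
    · rintro ⟨j, hj, hjN, hI, hψ, hφ⟩
      refine ⟨N - j, by omega, ?_, (ihψ hH (by omega)).1 hψ, fun i hi hij => ?_⟩
      · rwa [← hτ k k' j (N - j) hk (by omega) hj]
      · exact (ihφ hH (show N - i + i = N by omega)).1 (hφ _ (by omega) (by omega))
    · rintro ⟨j, hj, hI, hψ, hφ⟩
      refine ⟨N - j, by omega, by omega, ?_, (ihψ hH (by omega)).2 hψ, fun i hi hij => ?_⟩
      · rwa [hτ k k' (N - j) j hk (by omega) (by omega)]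
      · exact (ihφ hH (show i + (N - i) = N by omega)).2 (hφ _ (by omega) (by omega))
  | trig m n φ ψ ihφ ihψ =>
    simp only [sat, sigmaMap, Nat.cast_lt]
    constructor
    · intro h j hj hjN hI
      rw [← hτ (N - j) j k k' (by omega) hk (by omega)] at hI
      refine (h (N - j) (by omega) hI).imp (ihψ hH (by omega)).1 ?_
      rintro ⟨i, hi, hik, hφ⟩
      exact ⟨N - i, by omega, by omega, (ihφ hH (by omega)).1 hφ⟩
    · intro h j hj hI
      rw [hτ j (N - j) k k' (by omega) hk hj] at hI
      refine (h (N - j) (by omega) (by omega) hI).imp (ihψ hH (by omega)).2 ?_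
      rintro ⟨i, hi, hik, hφ⟩
      exact ⟨N - i, by omega, by omega, (ihφ hH (by omega)).2 hφ⟩
  | rel m n φ ψ ihφ ihψ =>
    simp only [sat, sigmaMap, Nat.cast_lt]
    constructor
    · intro h j hj hI
      rw [← hτ k k' (N - j) j hk (by omega) (by omega)] at hI
      refine (h (N - j) (by omega) (by omega) hI).imp (ihψ hH (by omega)).1 ?_
      rintro ⟨i, hi, hik, hφ⟩
      exact ⟨N - i, by omega, by omega, (ihφ hH (by omega)).1 hφ⟩
    · intro h j hj hjN hI
      rw [hτ k k' j (N - j) hk (by omega) hj] at hI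
      refine (h (N - j) (by omega) hI).imp (ihψ hH (by omega)).2 ?_
      rintro ⟨i, hi, hik, hφ⟩
      exact ⟨N - i, by omega, by omega, (ihφ hH (by omega)).2 hφ⟩

theorem isTrace.le_of_le {A : Type} {H T : ℕ → Set A} {τ : ℕ → ℕ} {N : ℕ}
    (h : isTrace H T τ ((N + 1 : ℕ) : ℕ∞)) {i j : ℕ} (hij : i ≤ j) (hj : j ≤ N) :
    τ i ≤ τ j := by
  induction j, hij using Nat.le_induction with
  | base => exact le_rfl
  | succ j _ ih => exact (ih (by omega)).trans (h.2.1 j (by norm_cast; omega))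

/-- The time reversal of a finite timed HT-trace is a timed HT-trace. -/
theorem isTrace.reverse {A : Type} {H T : ℕ → Set A} {τ : ℕ → ℕ} {N : ℕ}
    (h : isTrace H T τ ((N + 1 : ℕ) : ℕ∞)) :
    isTrace (fun i => H (N - i)) (fun i => T (N - i)) (fun i => τ N - τ (N - i))
      ((N + 1 : ℕ) : ℕ∞) := by
  refine ⟨fun i _ => h.1 _ (by norm_cast; omega), fun i _ => ?_, by simp⟩
  exact Nat.sub_le_sub_left (h.le_of_le (by omega) (by omega)) _

theorem finTaut.map_sigma {A : Type} {φ : MForm A} (hφ : finTaut φ) : finTaut (sigmaMap φ) := by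
  intro lam H T τ h k hk
  obtain ⟨N, rfl⟩ : ∃ N, lam = N + 1 := ⟨lam - 1, by omega⟩
  refine (sat_iff_sat_sigmaMap ?_ φ ?_ ?_ (show N - k + k = N by omega)).1
    (hφ _ _ _ _ h.reverse (N - k) (by omega))
  · intro i i' j j' hi hj hij
    have h₁ := h.le_of_le (show j' ≤ i' by omega) (by omega)
    have h₂ := h.le_of_le (show i' ≤ N by omega) le_rfl
    simp only [show N - i = i' by omega, show N - j = j' by omega]
    omega
  · intro i i' hi
    simp only [show N - i = i' by omega]
  · intro i i' hi
    simp only [show N - i = i' by omega]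

/-- Temporal Duality Theorem (Theorem 1). -/
theorem temporal_duality {A : Type} (φ : MForm A) :
    finTaut φ ↔ finTaut (sigmaMap φ) := by
  exact ⟨finTaut.map_sigma, fun h => by simpa only [sigmaMap_sigmaMap] using h.map_sigma⟩
end

section
/- Distributivity laws in MHT: for all metric formulas φ, ψ, χ over A and every interval I = [m,n), the following MHT-equivalences hold: ○_I(φ ∨ ψ) ≡ ○_I φ ∨ ○_I ψ; ○_I(φ ∧ ψ) ≡ ○_I φ ∧ ○_I ψ; ○̂_I(φ ∨ ψ) ≡ ○̂_I φ ∨ ○̂_I ψ; ○̂_I(φ ∧ ψ) ≡ ○̂_I φ ∧ ○̂_I ψ; ◇_I(φ ∨ ψ) ≡ ◇_I φ ∨ ◇_I ψ; ◻_I(φ ∧ ψ) ≡ ◻_I φ ∧ ◻_I ψ; φ U_I (χ ∨ ψ) ≡ (φ U_I χ) ∨ (φ U_I ψ); (φ ∧ χ) U_I ψ ≡ (φ U_I ψ) ∧ (χ U_I ψ); φ R_I (χ ∧ ψ) ≡ (φ R_I χ) ∧ (φ R_I ψ); (φ ∨ χ) R_I ψ ≡ (φ R_I ψ) ∨ (χ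 R_I ψ); •_I(φ ∨ ψ) ≡ •_I φ ∨ •_I ψ; •_I(φ ∧ ψ) ≡ •_I φ ∧ •_I ψ; •̂_I(φ ∨ ψ) ≡ •̂_I φ ∨ •̂_I ψ; •̂_I(φ ∧ ψ) ≡ •̂_I φ ∧ •̂_I ψ; ◆_I(φ ∨ ψ) ≡ ◆_I φ ∨ ◆_I ψ; ■_I(φ ∧ ψ) ≡ ■_I φ ∧ ■_I ψ; φ S_I (χ ∨ ψ) ≡ (φ S_I χ) ∨ (φ S_I ψ); (φ ∧ χ) S_I ψ ≡ (φ S_I ψ) ∧ (χ S_I ψ); φ T_I (χ ∧ ψ) ≡ (φ T_I χ) ∧ (φ T_I ψ); (φ ∨ χ) T_I ψ ≡ (φ T_I ψ) ∨ (χ T_I ψ). -/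
/-- MHT-equivalence: equal satisfaction at every index of every timed HT-trace. -/
def mhtEquiv {A : Type} (φ ψ : MForm A) : Prop :=
  ∀ (H T : ℕ → Set A) (τ : ℕ → ℕ) (len : ℕ∞),
    isTrace H T τ len → ∀ k : ℕ, (k : ℕ∞) < len →
      (sat φ H T τ len k ↔ sat ψ H T τ len k)

section Distributivity

variable {A : Type} (m : ℕ) (n : ℕ∞) (φ ψ χ : MForm A)

theorem next_disj : mhtEquiv (MForm.next m n (MForm.disj φ ψ))
    (MForm.disj (MForm.next m n φ) (MForm.next m n ψ)) := by
  intro H T τ len _ k _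
  simp only [sat]
  tauto

theorem next_conj : mhtEquiv (MForm.next m n (MForm.conj φ ψ))
    (MForm.conj (MForm.next m n φ) (MForm.next m n ψ)) := by
  intro H T τ len _ k _
  simp only [sat]
  tauto

theorem prev_disj : mhtEquiv (MForm.prev m n (MForm.disj φ ψ))
    (MForm.disj (MForm.prev m n φ) (MForm.prev m n ψ)) := by
  intro H T τ len _ k _
  simp only [sat]
  tauto

theorem prev_conj : mhtEquiv (MForm.prev m n (MForm.conj φ ψ))
    (MForm.conj (MForm.prev m n φ) (MForm.prev m n ψ)) := by
  intro H T τ len _ k _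
  simp only [sat]
  tauto

variable {φ ψ χ} in
theorem mhtEquiv.disj_right_of_disj {θ : MForm A} (h : mhtEquiv χ (MForm.disj φ ψ)) :
    mhtEquiv (MForm.disj χ θ) (MForm.disj (MForm.disj φ θ) (MForm.disj ψ θ)) := by
  intro H T τ len hM k hk
  have := h H T τ len hM k hk
  simp only [sat] at this ⊢
  tauto

variable {φ ψ χ} in
theorem mhtEquiv.disj_right_of_conj {θ : MForm A} (h : mhtEquiv χ (MForm.conj φ ψ)) :
    mhtEquiv (MForm.disj χ θ) (MForm.conj (MForm.disj φ θ) (MForm.disj ψ θ)) := by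
  intro H T τ len hM k hk
  have := h H T τ len hM k hk
  simp only [sat] at this ⊢
  tauto

theorem untl_disj : mhtEquiv (MForm.untl m n φ (MForm.disj χ ψ))
    (MForm.disj (MForm.untl m n φ χ) (MForm.untl m n φ ψ)) := by
  intro H T τ len _ k _
  simp only [sat, ← exists_or]
  exact exists_congr fun j => by tauto

theorem since_disj : mhtEquiv (MForm.since m n φ (MForm.disj χ ψ))
    (MForm.disj (MForm.since m n φ χ) (MForm.since m n φ ψ)) := by
  intro H T τ len _ k _
  simp only [sat, ← exists_or]
  exact exists_congr fun j => by tauto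

theorem rel_conj : mhtEquiv (MForm.rel m n φ (MForm.conj χ ψ))
    (MForm.conj (MForm.rel m n φ χ) (MForm.rel m n φ ψ)) := by
  intro H T τ len _ k _
  simp only [sat, ← forall_and]
  exact forall_congr' fun j => by tauto

theorem trig_conj : mhtEquiv (MForm.trig m n φ (MForm.conj χ ψ))
    (MForm.conj (MForm.trig m n φ χ) (MForm.trig m n φ ψ)) := by
  intro H T τ len _ k _
  simp only [sat, ← forall_and]
  exact forall_congr' fun j => by tauto

theorem conj_untl : mhtEquiv (MForm.untl m n (MForm.conj φ χ) ψ)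
    (MForm.conj (MForm.untl m n φ ψ) (MForm.untl m n χ ψ)) := by
  intro H T τ len _ k _
  simp only [sat]
  constructor
  · rintro ⟨j, hkj, hj, hI, hψ, h⟩
    exact ⟨⟨j, hkj, hj, hI, hψ, fun i hi hij => (h i hi hij).1⟩,
      ⟨j, hkj, hj, hI, hψ, fun i hi hij => (h i hi hij).2⟩⟩
  · rintro ⟨⟨j, hkj, hj, hI, hψ, h⟩, ⟨j', hkj', hj', hI', hψ', h'⟩⟩
    rcases le_total j j' with hle | hle
    · exact ⟨j, hkj, hj, hI, hψ, fun i hi hij => ⟨h i hi hij, h' i hi (hij.trans_le hle)⟩⟩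
    · exact ⟨j', hkj', hj', hI', hψ', fun i hi hij => ⟨h i hi (hij.trans_le hle), h' i hi hij⟩⟩

theorem conj_since : mhtEquiv (MForm.since m n (MForm.conj φ χ) ψ)
    (MForm.conj (MForm.since m n φ ψ) (MForm.since m n χ ψ)) := by
  intro H T τ len _ k _
  simp only [sat]
  constructor
  · rintro ⟨j, hjk, hI, hψ, h⟩
    exact ⟨⟨j, hjk, hI, hψ, fun i hji hi => (h i hji hi).1⟩,
      ⟨j, hjk, hI, hψ, fun i hji hi => (h i hji hi).2⟩⟩
  · rintro ⟨⟨j, hjk, hI, hψ, h⟩, ⟨j', hjk', hI', hψ', h'⟩⟩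
    rcases le_total j j' with hle | hle
    · exact ⟨j', hjk', hI', hψ', fun i hji hi => ⟨h i (hle.trans_lt hji) hi, h' i hji hi⟩⟩
    · exact ⟨j, hjk, hI, hψ, fun i hji hi => ⟨h i hji hi, h' i (hle.trans_lt hji) hi⟩⟩

theorem disj_rel : mhtEquiv (MForm.rel m n (MForm.disj φ χ) ψ)
    (MForm.disj (MForm.rel m n φ ψ) (MForm.rel m n χ ψ)) := by
  intro H T τ len _ k _
  simp only [sat]
  constructor
  · intro h
    by_contra! hcon
    obtain ⟨⟨j, hkj, hj, hI, hψ, hφ⟩, ⟨j', hkj', hj', hI', hψ', hχ⟩⟩ := hcon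
    rcases le_total j j' with hle | hle
    · rcases h j hkj hj hI with hs | ⟨i, hi, hij, hs | hs⟩
      exacts [hψ hs, hφ i hi hij hs, hχ i hi (hij.trans_le hle) hs]
    · rcases h j' hkj' hj' hI' with hs | ⟨i, hi, hij, hs | hs⟩
      exacts [hψ' hs, hφ i hi (hij.trans_le hle) hs, hχ i hi hij hs]
  · rintro (h | h) j hkj hj hI
    · exact (h j hkj hj hI).imp_right fun ⟨i, hi, hij, hs⟩ => ⟨i, hi, hij, Or.inl hs⟩
    · exact (h j hkj hj hI).imp_right fun ⟨i, hi, hij, hs⟩ => ⟨i, hi, hij, Or.inr hs⟩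

theorem disj_trig : mhtEquiv (MForm.trig m n (MForm.disj φ χ) ψ)
    (MForm.disj (MForm.trig m n φ ψ) (MForm.trig m n χ ψ)) := by
  intro H T τ len _ k _
  simp only [sat]
  constructor
  · intro h
    by_contra! hcon
    obtain ⟨⟨j, hjk, hI, hψ, hφ⟩, ⟨j', hjk', hI', hψ', hχ⟩⟩ := hcon
    rcases le_total j j' with hle | hle
    · rcases h j' hjk' hI' with hs | ⟨i, hji, hi, hs | hs⟩
      exacts [hψ' hs, hφ i (hle.trans_lt hji) hi hs, hχ i hji hi hs]
    · rcases h j hjk hI with hs | ⟨i, hji, hi, hs | hs⟩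
      exacts [hψ hs, hφ i hji hi hs, hχ i (hle.trans_lt hji) hi hs]
  · rintro (h | h) j hjk hI
    · exact (h j hjk hI).imp_right fun ⟨i, hji, hi, hs⟩ => ⟨i, hji, hi, Or.inl hs⟩
    · exact (h j hjk hI).imp_right fun ⟨i, hji, hi, hs⟩ => ⟨i, hji, hi, Or.inr hs⟩

end Distributivity

/-- Distributivity laws (Proposition 6). -/
theorem distributivity {A : Type} (m : ℕ) (n : ℕ∞) (φ ψ χ : MForm A) :
    mhtEquiv (MForm.next m n (MForm.disj φ ψ))
      (MForm.disj (MForm.next m n φ) (MForm.next m n ψ)) ∧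
    mhtEquiv (MForm.next m n (MForm.conj φ ψ))
      (MForm.conj (MForm.next m n φ) (MForm.next m n ψ)) ∧
    mhtEquiv (mWNext m n (MForm.disj φ ψ))
      (MForm.disj (mWNext m n φ) (mWNext m n ψ)) ∧
    mhtEquiv (mWNext m n (MForm.conj φ ψ))
      (MForm.conj (mWNext m n φ) (mWNext m n ψ)) ∧
    mhtEquiv (mEvent m n (MForm.disj φ ψ))
      (MForm.disj (mEvent m n φ) (mEvent m n ψ)) ∧
    mhtEquiv (mAlways m n (MForm.conj φ ψ))
      (MForm.conj (mAlways m n φ) (mAlways m n ψ)) ∧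
    mhtEquiv (MForm.untl m n φ (MForm.disj χ ψ))
      (MForm.disj (MForm.untl m n φ χ) (MForm.untl m n φ ψ)) ∧
    mhtEquiv (MForm.untl m n (MForm.conj φ χ) ψ)
      (MForm.conj (MForm.untl m n φ ψ) (MForm.untl m n χ ψ)) ∧
    mhtEquiv (MForm.rel m n φ (MForm.conj χ ψ))
      (MForm.conj (MForm.rel m n φ χ) (MForm.rel m n φ ψ)) ∧
    mhtEquiv (MForm.rel m n (MForm.disj φ χ) ψ)
      (MForm.disj (MForm.rel m n φ ψ) (MForm.rel m n χ ψ)) ∧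
    mhtEquiv (MForm.prev m n (MForm.disj φ ψ))
      (MForm.disj (MForm.prev m n φ) (MForm.prev m n ψ)) ∧
    mhtEquiv (MForm.prev m n (MForm.conj φ ψ))
      (MForm.conj (MForm.prev m n φ) (MForm.prev m n ψ)) ∧
    mhtEquiv (mWPrev m n (MForm.disj φ ψ))
      (MForm.disj (mWPrev m n φ) (mWPrev m n ψ)) ∧
    mhtEquiv (mWPrev m n (MForm.conj φ ψ))
      (MForm.conj (mWPrev m n φ) (mWPrev m n ψ)) ∧
    mhtEquiv (mEvB m n (MForm.disj φ ψ))
      (MForm.disj (mEvB m n φ) (mEvB m n ψ)) ∧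
    mhtEquiv (mAlwB m n (MForm.conj φ ψ))
      (MForm.conj (mAlwB m n φ) (mAlwB m n ψ)) ∧
    mhtEquiv (MForm.since m n φ (MForm.disj χ ψ))
      (MForm.disj (MForm.since m n φ χ) (MForm.since m n φ ψ)) ∧
    mhtEquiv (MForm.since m n (MForm.conj φ χ) ψ)
      (MForm.conj (MForm.since m n φ ψ) (MForm.since m n χ ψ)) ∧
    mhtEquiv (MForm.trig m n φ (MForm.conj χ ψ))
      (MForm.conj (MForm.trig m n φ χ) (MForm.trig m n φ ψ)) ∧
    mhtEquiv (MForm.trig m n (MForm.disj φ χ) ψ)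
      (MForm.disj (MForm.trig m n φ ψ) (MForm.trig m n χ ψ)) := by
  exact ⟨next_disj m n φ ψ, next_conj m n φ ψ,
    (next_disj m n φ ψ).disj_right_of_disj, (next_conj m n φ ψ).disj_right_of_conj,
    untl_disj m n mTop ψ φ, rel_conj m n MForm.bot ψ φ,
    untl_disj m n φ ψ χ, conj_untl m n φ ψ χ, rel_conj m n φ ψ χ, disj_rel m n φ ψ χ,
    prev_disj m n φ ψ, prev_conj m n φ ψ,
    (prev_disj m n φ ψ).disj_right_of_disj, (prev_conj m n φ ψ).disj_right_of_conj,
    since_disj m n mTop ψ φ, trig_conj m n MForm.bot ψ φ,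
    since_disj m n φ ψ χ, conj_since m n φ ψ χ, trig_conj m n φ ψ χ, disj_trig m n φ ψ χ⟩
end

section
/- De Morgan dualities for metric until/release and since/trigger: for all metric formulas φ, ψ over A and every interval I, the following MHT-equivalences hold: ¬(φ U_I ψ) ≡ ¬φ R_I ¬ψ; ¬(φ R_I ψ) ≡ ¬φ U_I ¬ψ; ¬(φ S_I ψ) ≡ ¬φ T_I ¬ψ; ¬(φ T_I ψ) ≡ ¬φ S_I ¬ψ. -/
/-- Satisfaction persists from the here-world `H` to the there-world `T`. -/
theorem sat_persistence {A : Type} {H T : ℕ → Set A} {τ : ℕ → ℕ} {len : ℕ∞}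
    (hHT : ∀ i : ℕ, (i : ℕ∞) < len → H i ⊆ T i) (φ : MForm A) {k : ℕ} (hk : (k : ℕ∞) < len)
    (h : sat φ H T τ len k) : sat φ T T τ len k := by
  have lt_len {i j : ℕ} (hij : i ≤ j) (hj : (j : ℕ∞) < len) : (i : ℕ∞) < len :=
    lt_of_le_of_lt (by exact_mod_cast hij) hj
  induction φ generalizing k with
  | bot => exact h
  | atom p => exact hHT k hk h
  | conj φ ψ ihφ ihψ => exact ⟨ihφ hk h.1, ihψ hk h.2⟩
  | disj φ ψ ihφ ihψ => exact h.imp (ihφ hk) (ihψ hk)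
  | impl φ ψ => exact ⟨h.2, h.2⟩
  | prev m n φ ih => exact ⟨h.1, ih (lt_len (Nat.sub_le k 1) hk) h.2.1, h.2.2⟩
  | since m n φ ψ ihφ ihψ =>
    obtain ⟨j, hjk, hI, hψ, hφ⟩ := h
    exact ⟨j, hjk, hI, ihψ (lt_len hjk hk) hψ,
      fun i hji hik => ihφ (lt_len hik hk) (hφ i hji hik)⟩
  | trig m n φ ψ ihφ ihψ =>
    exact fun j hjk hI => (h j hjk hI).imp (ihψ (lt_len hjk hk))
      fun ⟨i, hji, hik, hφ⟩ => ⟨i, hji, hik, ihφ (lt_len hik hk) hφ⟩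
  | next m n φ ih => exact ⟨h.1, ih (by exact_mod_cast h.1) h.2.1, h.2.2⟩
  | untl m n φ ψ ihφ ihψ =>
    obtain ⟨j, hkj, hj, hI, hψ, hφ⟩ := h
    exact ⟨j, hkj, hj, hI, ihψ hj hψ,
      fun i hki hij => ihφ (lt_len hij.le hj) (hφ i hki hij)⟩
  | rel m n φ ψ ihφ ihψ =>
    exact fun j hkj hj hI => (h j hkj hj hI).imp (ihψ hj)
      fun ⟨i, hki, hij, hφ⟩ => ⟨i, hki, hij, ihφ (lt_len hij.le hj) hφ⟩

/-- A negation holds exactly when the negated formula fails in the there-world. -/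
theorem sat_mNeg_iff {A : Type} {H T : ℕ → Set A} {τ : ℕ → ℕ} {len : ℕ∞}
    (hHT : ∀ i : ℕ, (i : ℕ∞) < len → H i ⊆ T i) (φ : MForm A) {k : ℕ} (hk : (k : ℕ∞) < len) :
    sat (mNeg φ) H T τ len k ↔ ¬ sat φ T T τ len k := by
  simp only [mNeg, sat, or_false]
  exact ⟨And.right, fun h => ⟨fun hH => h (sat_persistence hHT φ hk hH), h⟩⟩

/-- De Morgan dualities between until/release and since/trigger (Proposition 8). -/
theorem de_morgan_metric {A : Type} (m : ℕ) (n : ℕ∞) (φ ψ : MForm A) :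
    mhtEquiv (mNeg (MForm.untl m n φ ψ)) (MForm.rel m n (mNeg φ) (mNeg ψ)) ∧
    mhtEquiv (mNeg (MForm.rel m n φ ψ)) (MForm.untl m n (mNeg φ) (mNeg ψ)) ∧
    mhtEquiv (mNeg (MForm.since m n φ ψ)) (MForm.trig m n (mNeg φ) (mNeg ψ)) ∧
    mhtEquiv (mNeg (MForm.trig m n φ ψ)) (MForm.since m n (mNeg φ) (mNeg ψ)) := by
  have lt_len {len : ℕ∞} {i j : ℕ} (hij : i ≤ j) (hj : (j : ℕ∞) < len) : (i : ℕ∞) < len :=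
    lt_of_le_of_lt (by exact_mod_cast hij) hj
  refine ⟨?_, ?_, ?_, ?_⟩ <;> intro H T τ len ⟨hHT, _⟩ k hk <;>
    rw [sat_mNeg_iff hHT _ hk] <;> simp only [sat] <;> push Not
  · refine forall_congr' fun j => forall_congr' fun _ => forall_congr' fun hj =>
      forall_congr' fun _ => ?_
    rw [sat_mNeg_iff hHT _ hj, ← imp_iff_not_or]
    refine imp_congr_right fun _ => exists_congr fun i => and_congr_right fun _ =>
      and_congr_right fun hij => (sat_mNeg_iff hHT φ (lt_len hij.le hj)).symm
  · refine exists_congr fun j => and_congr_right fun _ => and_congr_right fun hj =>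
      and_congr_right fun _ => and_congr (sat_mNeg_iff hHT ψ hj).symm ?_
    exact forall_congr' fun i => forall_congr' fun _ => forall_congr' fun hij =>
      (sat_mNeg_iff hHT φ (lt_len hij.le hj)).symm
  · refine forall_congr' fun j => forall_congr' fun hj => forall_congr' fun _ => ?_
    rw [sat_mNeg_iff hHT _ (lt_len hj hk), ← imp_iff_not_or]
    refine imp_congr_right fun _ => exists_congr fun i => and_congr_right fun _ =>
      and_congr_right fun hik => (sat_mNeg_iff hHT φ (lt_len hik hk)).symm
  · refine exists_congr fun j => and_congr_right fun hj => and_congr_right fun _ =>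
      and_congr (sat_mNeg_iff hHT ψ (lt_len hj hk)).symm ?_
    exact forall_congr' fun i => forall_congr' fun _ => forall_congr' fun hik =>
      (sat_mNeg_iff hHT φ (lt_len hik hk)).symm
end

section
/- Unfolding at singleton intervals: for all metric formulas φ, ψ over A and every n > 0, the following equivalences hold over strict timed HT-traces (writing [m,m] for [m,m+1)): ψ U_{[n,n]} φ ≡ ψ ∧ ⋁_{i=1}^{n} ○_{[i,i]}(ψ U_{[n−i,n−i]} φ); ψ R_{[n,n]} φ ≡ ψ ∨ ⋀_{i=1}^{n} ○̂_{[i,i]}(ψ R_{[n−i,n−i]} φ); ◇_{[n,n]} φ ≡ ⋁_{i=1}^{n} ○_{[i,i]} ◇_{[n−i,n−i]} φ; ◻_{[n,n]} φ ≡ ⋀_{i=1}^{n} ○̂_{[i,i]} ◻_{[n−i,n−i]} φ. -/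
/-- MHT-equivalence over strict timed HT-traces. -/
def mhtEquivStrict {A : Type} (φ ψ : MForm A) : Prop :=
  ∀ (H T : ℕ → Set A) (τ : ℕ → ℕ) (len : ℕ∞),
    isTrace H T τ len → isStrict τ len → ∀ k : ℕ, (k : ℕ∞) < len →
      (sat φ H T τ len k ↔ sat ψ H T τ len k)

/-- Finite disjunction of a list of formulas (`⊥` for the empty list). -/
def bigOr {A : Type} : List (MForm A) → MForm A
  | [] => MForm.bot
  | f :: fs => MForm.disj f (bigOr fs)

/-- Finite conjunction of a list of formulas (`⊤` for the empty list). -/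
def bigAnd {A : Type} : List (MForm A) → MForm A
  | [] => mTop
  | f :: fs => MForm.conj f (bigAnd fs)

theorem inIntv_singleton (n d : ℕ) : inIntv n ((n : ℕ∞) + 1) d ↔ d = n := by
  unfold inIntv
  have h : ((d : ℕ∞) < (n : ℕ∞) + 1) ↔ d < n + 1 := by exact_mod_cast Iff.rfl
  rw [h]
  omega

theorem inIntv_succ_singleton (j d : ℕ) : inIntv (j + 1) ((j : ℕ∞) + 2) d ↔ d = j + 1 := by
  unfold inIntv
  have h : ((d : ℕ∞) < (j : ℕ∞) + 2) ↔ d < j + 2 := by exact_mod_cast Iff.rfl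
  rw [h]
  omega

section Semantics

variable {A : Type} {H T : ℕ → Set A} {τ : ℕ → ℕ} {len : ℕ∞} {k : ℕ}

theorem sat_mTop : sat (mTop : MForm A) H T τ len k := by
  simp [mTop, mNeg, sat]

theorem sat_bigOr (l : List (MForm A)) :
    sat (bigOr l) H T τ len k ↔ ∃ f ∈ l, sat f H T τ len k := by
  induction l with
  | nil => simp [bigOr, sat]
  | cons f fs ih => simp [bigOr, sat, ih]

theorem sat_bigAnd (l : List (MForm A)) :
    sat (bigAnd l) H T τ len k ↔ ∀ f ∈ l, sat f H T τ len k := by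
  induction l with
  | nil => simp [bigAnd, sat_mTop]
  | cons f fs ih => simp [bigAnd, sat, ih]

theorem sat_mWNext (m : ℕ) (n : ℕ∞) (φ : MForm A) :
    sat (mWNext m n φ) H T τ len k ↔
      ((k : ℕ∞) + 1 < len → inIntv m n (τ (k + 1) - τ k) → sat φ H T τ len (k + 1)) := by
  simp only [mWNext, mNeg, sat, sat_mTop]
  tauto

theorem isStrict.monotone (hs : isStrict τ len) {i j : ℕ} (hij : i ≤ j) (hj : (j : ℕ∞) < len) :
    τ i ≤ τ j := by
  induction j, hij using Nat.le_induction with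
  | base => exact le_rfl
  | succ j _ ih =>
    have hj' : (j : ℕ∞) + 1 < len := by exact_mod_cast hj
    exact (ih (lt_of_le_of_lt le_self_add hj')).trans (hs j hj').le

theorem succ_lt_of_lt {j : ℕ} (hkj : k < j) (hj : (j : ℕ∞) < len) : (k : ℕ∞) + 1 < len :=
  lt_of_le_of_lt (by exact_mod_cast hkj) hj

theorem sat_untl_singleton (hs : isStrict τ len) (φ ψ : MForm A) {n : ℕ} (hn : 0 < n) :
    sat (MForm.untl n ((n : ℕ∞) + 1) ψ φ) H T τ len k ↔
      sat ψ H T τ len k ∧ sat (bigOr ((List.range n).map (fun j =>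
        MForm.next (j+1) ((j : ℕ∞) + 2)
          (MForm.untl (n - (j+1)) (((n - (j+1) : ℕ) : ℕ∞) + 1) ψ φ)))) H T τ len k := by
  simp only [sat_bigOr, List.mem_map, exists_exists_and_eq_and, List.mem_range, sat,
    inIntv_singleton, inIntv_succ_singleton]
  constructor
  · rintro ⟨j, hkj, hj, hd, hφ, hψ⟩
    have hlt : k < j := lt_of_le_of_ne hkj (by rintro rfl; omega)
    have hk := succ_lt_of_lt hlt hj
    have h₁ := hs k hk
    have h₂ := hs.monotone hlt hj
    simp only [Nat.succ_eq_add_one] at h₂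
    exact ⟨hψ k le_rfl hlt, τ (k + 1) - τ k - 1, by omega, hk,
      ⟨j, hlt, hj, by omega, hφ, fun i hi hij => hψ i (by omega) hij⟩, by omega⟩
  · rintro ⟨hk, d, hd, _, ⟨j, hlt, hj, hdj, hφ, hψ⟩, hτ⟩
    have h₂ := hs.monotone hlt hj
    refine ⟨j, by omega, hj, by omega, hφ, fun i hi hij => ?_⟩
    obtain rfl | hi := hi.eq_or_lt
    · exact hk
    · exact hψ i hi hij

theorem sat_rel_singleton (hs : isStrict τ len) (φ ψ : MForm A) {n : ℕ} (hn : 0 < n) :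
    sat (MForm.rel n ((n : ℕ∞) + 1) ψ φ) H T τ len k ↔
      sat ψ H T τ len k ∨ sat (bigAnd ((List.range n).map (fun j =>
        mWNext (j+1) ((j : ℕ∞) + 2)
          (MForm.rel (n - (j+1)) (((n - (j+1) : ℕ) : ℕ∞) + 1) ψ φ)))) H T τ len k := by
  simp only [sat_bigAnd, List.forall_mem_map, List.mem_range, sat_mWNext, sat,
    inIntv_singleton, inIntv_succ_singleton]
  constructor
  · intro h
    refine or_iff_not_imp_left.2 fun hk d hd _ hτ j hlt hj hdj => ?_
    have h₂ := hs.monotone hlt hj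
    refine (h j (by omega) hj (by omega)).imp_right ?_
    rintro ⟨i, hi, hij, hψ⟩
    exact ⟨i, lt_of_le_of_ne hi (by rintro rfl; exact hk hψ), hij, hψ⟩
  · intro h j hkj hj hd
    have hlt : k < j := lt_of_le_of_ne hkj (by rintro rfl; omega)
    obtain hψ | h := h
    · exact Or.inr ⟨k, le_rfl, hlt, hψ⟩
    have hk := succ_lt_of_lt hlt hj
    have h₁ := hs k hk
    have h₂ := hs.monotone hlt hj
    simp only [Nat.succ_eq_add_one] at h₂
    refine (h (τ (k + 1) - τ k - 1) (by omega) hk (by omega) j hlt hj (by omega)).imp_right ?_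
    rintro ⟨i, hi, hij, hψ⟩
    exact ⟨i, by omega, hij, hψ⟩

end Semantics

/-- Unfolding at singleton intervals `[n,n] = [n,n+1)` (Lemma 2). -/
theorem singleton_unfolding {A : Type} (φ ψ : MForm A) (n : ℕ) (hn : 0 < n) :
    mhtEquivStrict (MForm.untl n ((n : ℕ∞) + 1) ψ φ)
      (MForm.conj ψ (bigOr ((List.range n).map (fun j =>
        MForm.next (j+1) ((j : ℕ∞) + 2)
          (MForm.untl (n - (j+1)) (((n - (j+1) : ℕ) : ℕ∞) + 1) ψ φ))))) ∧
    mhtEquivStrict (MForm.rel n ((n : ℕ∞) + 1) ψ φ)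
      (MForm.disj ψ (bigAnd ((List.range n).map (fun j =>
        mWNext (j+1) ((j : ℕ∞) + 2)
          (MForm.rel (n - (j+1)) (((n - (j+1) : ℕ) : ℕ∞) + 1) ψ φ))))) ∧
    mhtEquivStrict (mEvent n ((n : ℕ∞) + 1) φ)
      (bigOr ((List.range n).map (fun j =>
        MForm.next (j+1) ((j : ℕ∞) + 2)
          (mEvent (n - (j+1)) (((n - (j+1) : ℕ) : ℕ∞) + 1) φ)))) ∧
    mhtEquivStrict (mAlways n ((n : ℕ∞) + 1) φ)
      (bigAnd ((List.range n).map (fun j =>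
        mWNext (j+1) ((j : ℕ∞) + 2)
          (mAlways (n - (j+1)) (((n - (j+1) : ℕ) : ℕ∞) + 1) φ)))) := by
  refine ⟨?_, ?_, ?_, ?_⟩ <;> intro H T τ len _ hs k _
  · exact sat_untl_singleton hs φ ψ hn
  · exact sat_rel_singleton hs φ ψ hn
  · exact (sat_untl_singleton hs φ mTop hn).trans (and_iff_right sat_mTop)
  · exact (sat_rel_singleton hs φ MForm.bot hn).trans (or_iff_right (by simp [sat]))
end

section
/- Range splitting: for all metric formulas φ, ψ over A, all m ∈ ℕ, n ∈ ℕ ∪ {ω}, and every i with m ≤ i < n, the following equivalences hold over strict timed HT-traces: ψ U_{[m,n)} φ ≡ (ψ U_{[m,i)} φ) ∨ (ψ U_{[i,n)} φ), and ψ R_{[m,n)} φ ≡ (ψ R_{[m,i)} φ) ∧ (ψ R_{[i,n)} φ). -/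
theorem inIntv_split {m i : ℕ} {n : ℕ∞} (hmi : m ≤ i) (hin : (i : ℕ∞) < n) (d : ℕ) :
    inIntv m n d ↔ inIntv m i d ∨ inIntv i n d := by
  simp only [inIntv, Nat.cast_lt]
  constructor
  · rintro ⟨hm, hn⟩
    exact (lt_or_ge d i).imp (fun h => ⟨hm, h⟩) (fun h => ⟨h, hn⟩)
  · rintro (⟨hm, hi⟩ | ⟨hi, hn⟩)
    · exact ⟨hm, lt_trans (Nat.cast_lt.mpr hi) hin⟩
    · exact ⟨hmi.trans hi, hn⟩

/-- Range splitting (Theorem 3). -/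
theorem range_splitting {A : Type} (φ ψ : MForm A) (m : ℕ) (n : ℕ∞) (i : ℕ)
    (hmi : m ≤ i) (hin : (i : ℕ∞) < n) :
    mhtEquivStrict (MForm.untl m n ψ φ)
      (MForm.disj (MForm.untl m (i : ℕ∞) ψ φ) (MForm.untl i n ψ φ)) ∧
    mhtEquivStrict (MForm.rel m n ψ φ)
      (MForm.conj (MForm.rel m (i : ℕ∞) ψ φ) (MForm.rel i n ψ φ)) := by
  constructor
  · intro H T τ len _ _ k _
    simp only [sat, inIntv_split hmi hin, or_and_right, and_or_left, exists_or]
  · intro H T τ len _ _ k _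
    simp only [sat, inIntv_split hmi hin, or_imp, imp_and, forall_and]
end

section
/- Model correspondence for the first-order translation (Kamp-style): let φ be a metric formula over A all of whose interval annotations [m,n) are nonempty (m < n), let (⟨H,T⟩,τ) be a strict timed HT-trace of length λ > 0, and let ⟨D,H*,T*⟩ be its associated QHT[≼_δ] interpretation, where D := {τ(i) : 0 ≤ i < λ}, H* := {p(τ(i)) : 0 ≤ i < λ, p ∈ H_i}, and T* := {p(τ(i)) : 0 ≤ i < λ, p ∈ T_i}. Then for every 0 ≤ i < λ: (⟨H,T⟩,τ),i ⊨ φ if and only if ⟨D,H*,T*⟩ ⊨ tr(φ)_{τ(i)}, and (⟨T,T⟩,τ),i ⊨ φ if and only if ⟨D,T*,T*⟩ ⊨ tr(φ)_{τ(i)}. -/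
/-- First-order terms: de Bruijn variables or constant time points. -/
inductive FTerm : Type where
  | var : ℕ → FTerm
  | const : ℕ → FTerm

/-- Lift a term under one extra binder. -/
def FTerm.lift : FTerm → FTerm
  | .var i => .var (i+1)
  | .const d => .const d

/-- Value of a term under an environment for the de Bruijn variables. -/
def FTerm.val (ρ : ℕ → ℕ) : FTerm → ℕ
  | .var i => ρ i
  | .const d => d

/-- First-order metric (FOM) formulas: monadic predicates for atoms and the
difference predicates `t₁ ≼_δ t₂` with `δ ∈ ℤ ∪ {ω}` (here `⊤ : WithTop ℤ`). -/
inductive FOM (A : Type) : Type where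
  | bot  : FOM A
  | atom : A → FTerm → FOM A
  | le   : WithTop ℤ → FTerm → FTerm → FOM A
  | conj : FOM A → FOM A → FOM A
  | disj : FOM A → FOM A → FOM A
  | impl : FOM A → FOM A → FOM A
  | all  : FOM A → FOM A
  | ex   : FOM A → FOM A

/-- Extend an environment with a value for the newly bound variable. -/
def consEnv (d : ℕ) (ρ : ℕ → ℕ) : ℕ → ℕ
  | 0 => d
  | i+1 => ρ i

/-- QHT[≼_δ] satisfaction `⟨D,Hs,Ts⟩ ⊨ φ` (with environment `ρ`). -/
def fomSat {A : Type} : FOM A → Set ℕ → Set (A × ℕ) → Set (A × ℕ) → (ℕ → ℕ) → Prop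
  | .bot, _, _, _, _ => False
  | .atom p t, _, Hs, _, ρ => (p, t.val ρ) ∈ Hs
  | .le δ t₁ t₂, _, _, _, ρ => (((t₁.val ρ : ℤ) - (t₂.val ρ : ℤ) : ℤ) : WithTop ℤ) ≤ δ
  | .conj φ ψ, D, Hs, Ts, ρ => fomSat φ D Hs Ts ρ ∧ fomSat ψ D Hs Ts ρ
  | .disj φ ψ, D, Hs, Ts, ρ => fomSat φ D Hs Ts ρ ∨ fomSat ψ D Hs Ts ρ
  | .impl φ ψ, D, Hs, Ts, ρ =>
      (¬ fomSat φ D Hs Ts ρ ∨ fomSat ψ D Hs Ts ρ) ∧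
      (¬ fomSat φ D Ts Ts ρ ∨ fomSat ψ D Ts Ts ρ)
  | .all φ, D, Hs, Ts, ρ => ∀ d ∈ D, fomSat φ D Hs Ts (consEnv d ρ)
  | .ex φ, D, Hs, Ts, ρ => ∃ d ∈ D, fomSat φ D Hs Ts (consEnv d ρ)

/-- `¬α := α → ⊥`. -/
def fomNeg {A : Type} (φ : FOM A) : FOM A := FOM.impl φ FOM.bot

/-- `t₁ ≤ t₂ := t₁ ≼₀ t₂`. -/
def fomLe {A : Type} (t₁ t₂ : FTerm) : FOM A := FOM.le 0 t₁ t₂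

/-- `t₁ = t₂ := t₁ ≤ t₂ ∧ t₂ ≤ t₁`. -/
def fomEq {A : Type} (t₁ t₂ : FTerm) : FOM A := FOM.conj (fomLe t₁ t₂) (fomLe t₂ t₁)

/-- `t₁ < t₂ := t₁ ≤ t₂ ∧ ¬(t₁ = t₂)`. -/
def fomLt {A : Type} (t₁ t₂ : FTerm) : FOM A :=
  FOM.conj (fomLe t₁ t₂) (fomNeg (fomEq t₁ t₂))

/-- `t₁ ≼_{-m} t₂` for `m : ℕ`. -/
def fomLeNeg {A : Type} (m : ℕ) (t₁ t₂ : FTerm) : FOM A := FOM.le (-(m : ℤ)) t₁ t₂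

/-- `t₁ ≺_n t₂ := ¬(t₂ ≼_{-n} t₁)`; for `n = ω` this is `¬⊥ = ⊤`. -/
def fomPrec {A : Type} (n : ℕ∞) (t₁ t₂ : FTerm) : FOM A :=
  if n = ⊤ then fomNeg FOM.bot
  else fomNeg (FOM.le (-(n.toNat : ℤ)) t₂ t₁)

/-- The Kamp-style translation `tr(φ)ₓ` (Definition 7). -/
def tr {A : Type} : MForm A → FTerm → FOM A
  | .bot, _ => .bot
  | .atom p, t => .atom p t
  | .conj φ ψ, t => .conj (tr φ t) (tr ψ t)
  | .disj φ ψ, t => .disj (tr φ t) (tr ψ t)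
  | .impl φ ψ, t => .impl (tr φ t) (tr ψ t)
  | .next m n ψ, t =>
      .ex (.conj (fomLt t.lift (.var 0))
          (.conj (fomNeg (.ex (.conj (fomLt t.lift.lift (.var 0)) (fomLt (.var 0) (.var 1)))))
          (.conj (fomLeNeg m t.lift (.var 0))
          (.conj (fomPrec n (.var 0) t.lift)
                 (tr ψ (.var 0))))))
  | .untl m n φ ψ, t =>
      .ex (.conj (fomLe t.lift (.var 0))
          (.conj (fomLeNeg m t.lift (.var 0))
          (.conj (fomPrec n (.var 0) t.lift)
          (.conj (tr ψ (.var 0))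
                 (.all (.impl (.conj (fomLe t.lift.lift (.var 0)) (fomLt (.var 0) (.var 1)))
                              (tr φ (.var 0))))))))
  | .rel m n φ ψ, t =>
      .all (.impl (.conj (fomLe t.lift (.var 0))
                  (.conj (fomLeNeg m t.lift (.var 0)) (fomPrec n (.var 0) t.lift)))
            (.disj (tr ψ (.var 0))
                   (.ex (.conj (fomLe t.lift.lift (.var 0))
                        (.conj (fomLt (.var 0) (.var 1)) (tr φ (.var 0)))))))
  | .prev m n ψ, t =>
      .ex (.conj (fomLt (.var 0) t.lift)
          (.conj (fomNeg (.ex (.conj (fomLt (.var 1) (.var 0)) (fomLt (.var 0) t.lift.lift))))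
          (.conj (fomPrec n t.lift (.var 0))
          (.conj (fomLeNeg m (.var 0) t.lift)
                 (tr ψ (.var 0))))))
  | .since m n φ ψ, t =>
      .ex (.conj (fomLe (.var 0) t.lift)
          (.conj (fomPrec n t.lift (.var 0))
          (.conj (fomLeNeg m (.var 0) t.lift)
          (.conj (tr ψ (.var 0))
                 (.all (.impl (.conj (fomLt (.var 1) (.var 0)) (fomLe (.var 0) t.lift.lift))
                              (tr φ (.var 0))))))))
  | .trig m n φ ψ, t =>
      .all (.impl (.conj (fomLe (.var 0) t.lift)
                  (.conj (fomPrec n t.lift (.var 0)) (fomLeNeg m (.var 0) t.lift)))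
            (.disj (tr ψ (.var 0))
                   (.ex (.conj (fomLt (.var 1) (.var 0))
                        (.conj (fomLe (.var 0) t.lift.lift) (tr φ (.var 0)))))))

/-- All interval annotations `[m,n)` of the formula are nonempty (`m < n`). -/
def goodIntervals {A : Type} : MForm A → Prop
  | .bot => True
  | .atom _ => True
  | .conj φ ψ => goodIntervals φ ∧ goodIntervals ψ
  | .disj φ ψ => goodIntervals φ ∧ goodIntervals ψ
  | .impl φ ψ => goodIntervals φ ∧ goodIntervals ψ
  | .prev m n φ => (m : ℕ∞) < n ∧ goodIntervals φ
  | .next m n φ => (m : ℕ∞) < n ∧ goodIntervals φ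
  | .since m n φ ψ => (m : ℕ∞) < n ∧ goodIntervals φ ∧ goodIntervals ψ
  | .trig m n φ ψ => (m : ℕ∞) < n ∧ goodIntervals φ ∧ goodIntervals ψ
  | .untl m n φ ψ => (m : ℕ∞) < n ∧ goodIntervals φ ∧ goodIntervals ψ
  | .rel m n φ ψ => (m : ℕ∞) < n ∧ goodIntervals φ ∧ goodIntervals ψ

/-- Strict timing makes `τ` strictly monotone on the positions of the trace. -/
theorem isStrict.lt_of_lt {τ : ℕ → ℕ} {len : ℕ∞} (h : isStrict τ len) {i j : ℕ}
    (hij : i < j) (hj : (j : ℕ∞) < len) : τ i < τ j := by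
  induction j, hij using Nat.le_induction with
  | base => exact h i (by exact_mod_cast hj)
  | succ j hij ih =>
    have hj' : (j : ℕ∞) + 1 < len := by exact_mod_cast hj
    exact (ih (lt_of_le_of_lt le_self_add hj')).trans (h j hj')

theorem isStrict.lt_iff_lt {τ : ℕ → ℕ} {len : ℕ∞} (h : isStrict τ len) {i j : ℕ}
    (hi : (i : ℕ∞) < len) (hj : (j : ℕ∞) < len) : τ i < τ j ↔ i < j := by
  refine ⟨fun hlt => ?_, fun hij => h.lt_of_lt hij hj⟩
  by_contra hij
  rcases (not_lt.1 hij).eq_or_lt with rfl | hji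
  · exact lt_irrefl _ hlt
  · exact lt_asymm hlt (h.lt_of_lt hji hi)

theorem isStrict.le_iff_le {τ : ℕ → ℕ} {len : ℕ∞} (h : isStrict τ len) {i j : ℕ}
    (hi : (i : ℕ∞) < len) (hj : (j : ℕ∞) < len) : τ i ≤ τ j ↔ i ≤ j := by
  simpa only [not_lt] using not_congr (h.lt_iff_lt hj hi)

theorem isStrict.eq_iff_eq {τ : ℕ → ℕ} {len : ℕ∞} (h : isStrict τ len) {i j : ℕ}
    (hi : (i : ℕ∞) < len) (hj : (j : ℕ∞) < len) : τ i = τ j ↔ i = j := by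
  simp only [le_antisymm_iff, h.le_iff_le hi hj, h.le_iff_le hj hi]

/-- Every position below a position of the trace is a position of the trace. -/
theorem natCast_lt_of_le_of_lt {i j : ℕ} {len : ℕ∞} (hij : i ≤ j) (hj : (j : ℕ∞) < len) :
    (i : ℕ∞) < len :=
  lt_of_le_of_lt (by exact_mod_cast hij) hj

section FirstOrder

variable {A : Type} {D : Set ℕ} {Hs Ts : Set (A × ℕ)} {ρ : ℕ → ℕ}

theorem FTerm.val_lift_consEnv (d : ℕ) (ρ : ℕ → ℕ) (t : FTerm) :
    t.lift.val (consEnv d ρ) = t.val ρ := by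
  cases t <;> rfl

theorem FTerm.val_var (ρ : ℕ → ℕ) (k : ℕ) : (FTerm.var k).val ρ = ρ k :=
  rfl

/-- Persistence: what holds here holds there. -/
theorem fomSat.there (h : Hs ⊆ Ts) {φ : FOM A} (hφ : fomSat φ D Hs Ts ρ) :
    fomSat φ D Ts Ts ρ := by
  induction φ generalizing ρ with
  | bot => exact hφ
  | atom p t => exact h hφ
  | le δ t₁ t₂ => exact hφ
  | conj φ ψ ihφ ihψ => exact hφ.imp ihφ ihψ
  | disj φ ψ ihφ ihψ => exact Or.imp ihφ ihψ hφ
  | impl φ ψ _ _ => exact ⟨hφ.2, hφ.2⟩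
  | all φ ih => exact fun d hd => ih (hφ d hd)
  | ex φ ih => exact hφ.imp fun d hd => ⟨hd.1, ih hd.2⟩

theorem fomSat_conj (φ ψ : FOM A) :
    fomSat (.conj φ ψ) D Hs Ts ρ ↔ fomSat φ D Hs Ts ρ ∧ fomSat ψ D Hs Ts ρ :=
  Iff.rfl

/-- An implication whose antecedent has the same truth value here and there. -/
theorem fomSat_impl_of_iff (h : Hs ⊆ Ts) {φ ψ : FOM A} {p : Prop}
    (hφ : ∀ X, fomSat φ D X Ts ρ ↔ p) :
    fomSat (.impl φ ψ) D Hs Ts ρ ↔ (p → fomSat ψ D Hs Ts ρ) := by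
  have := fomSat.there (D := D) (ρ := ρ) (φ := ψ) h
  simp only [fomSat, hφ]
  tauto

theorem fomSat_fomNeg_of_iff {φ : FOM A} {p : Prop} (hφ : ∀ X, fomSat φ D X Ts ρ ↔ p) :
    fomSat (fomNeg φ) D Hs Ts ρ ↔ ¬ p := by
  simp only [fomNeg, fomSat, hφ, or_false, and_self]

theorem fomSat_fomLe (t₁ t₂ : FTerm) :
    fomSat (fomLe t₁ t₂) D Hs Ts ρ ↔ t₁.val ρ ≤ t₂.val ρ := by
  simp only [fomLe, fomSat]
  rw [← WithTop.coe_zero, WithTop.coe_le_coe, sub_nonpos, Nat.cast_le]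

theorem fomSat_fomLt (t₁ t₂ : FTerm) :
    fomSat (fomLt t₁ t₂) D Hs Ts ρ ↔ t₁.val ρ < t₂.val ρ := by
  simp only [fomLt, fomNeg, fomEq, fomSat, fomSat_fomLe, or_false, and_self, not_and, not_le]
  omega

theorem fomSat_fomLeNeg (m : ℕ) (t₁ t₂ : FTerm) :
    fomSat (fomLeNeg m t₁ t₂) D Hs Ts ρ ↔ t₁.val ρ + m ≤ t₂.val ρ := by
  simp only [fomLeNeg, fomSat]
  rw [← WithTop.LinearOrderedAddCommGroup.coe_neg, WithTop.coe_le_coe]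
  change (t₁.val ρ : ℤ) - t₂.val ρ ≤ -(m : ℤ) ↔ _
  omega

theorem fomSat_fomPrec (n : ℕ∞) (t₁ t₂ : FTerm) :
    fomSat (fomPrec n t₁ t₂) D Hs Ts ρ ↔ (t₁.val ρ : ℕ∞) < t₂.val ρ + n := by
  induction n using ENat.recTopCoe with
  | top => simp [fomPrec, fomNeg, fomSat]
  | coe n =>
    simp only [fomPrec, fomNeg, fomSat, ENat.natCast_ne_top, if_false, ENat.toNat_natCast]
    rw [← WithTop.LinearOrderedAddCommGroup.coe_neg, WithTop.coe_le_coe, ← Nat.cast_add,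
      Nat.cast_lt, or_false, and_self]
    change ¬ (t₂.val ρ : ℤ) - t₁.val ρ ≤ -(n : ℤ) ↔ _
    omega

end FirstOrder

/-- Membership of an elapsed time in `[m, n)`, without subtraction. -/
theorem inIntv_sub_iff {m : ℕ} {n : ℕ∞} {a b : ℕ} (hab : a ≤ b) :
    inIntv m n (b - a) ↔ a + m ≤ b ∧ (b : ℕ∞) < a + n := by
  refine and_congr (by omega) ?_
  induction n using ENat.recTopCoe with
  | top => simpa using (ENat.natCast_lt_top (b - a))
  | coe n =>
    rw [← Nat.cast_add, Nat.cast_lt, Nat.cast_lt]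
    omega

/-- The time points of a timed trace. -/
def timeSet (τ : ℕ → ℕ) (len : ℕ∞) : Set ℕ :=
  {d | ∃ j : ℕ, (j : ℕ∞) < len ∧ τ j = d}

/-- The timestamped atoms of a timed trace. -/
def factSet {A : Type} (H : ℕ → Set A) (τ : ℕ → ℕ) (len : ℕ∞) : Set (A × ℕ) :=
  {q | ∃ j : ℕ, (j : ℕ∞) < len ∧ q.2 = τ j ∧ q.1 ∈ H j}

theorem factSet_mono {A : Type} {H T : ℕ → Set A} {τ : ℕ → ℕ} {len : ℕ∞}
    (h : ∀ j : ℕ, (j : ℕ∞) < len → H j ⊆ T j) : factSet H τ len ⊆ factSet T τ len :=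
  fun _ ⟨j, hj, hq, hH⟩ => ⟨j, hj, hq, h j hj hH⟩

section TimeSet

variable {A : Type} {τ : ℕ → ℕ} {len : ℕ∞} {Hs Ts : Set (A × ℕ)} {ρ : ℕ → ℕ}

theorem fomSat_ex_timeSet (φ : FOM A) :
    fomSat (.ex φ) (timeSet τ len) Hs Ts ρ ↔
      ∃ j : ℕ, (j : ℕ∞) < len ∧ fomSat φ (timeSet τ len) Hs Ts (consEnv (τ j) ρ) := by
  constructor
  · rintro ⟨_, ⟨j, hj, rfl⟩, h⟩
    exact ⟨j, hj, h⟩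
  · rintro ⟨j, hj, h⟩
    exact ⟨_, ⟨j, hj, rfl⟩, h⟩

/-- Bounded universal quantification over the time points of a trace. -/
theorem fomSat_all_impl_timeSet (h : Hs ⊆ Ts) {φ ψ : FOM A} {p : ℕ → Prop}
    (hφ : ∀ j : ℕ, (j : ℕ∞) < len →
      ∀ X, fomSat φ (timeSet τ len) X Ts (consEnv (τ j) ρ) ↔ p j) :
    fomSat (.all (.impl φ ψ)) (timeSet τ len) Hs Ts ρ ↔
      ∀ j : ℕ, (j : ℕ∞) < len → p j → fomSat ψ (timeSet τ len) Hs Ts (consEnv (τ j) ρ) := by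
  constructor
  · exact fun hall j hj => (fomSat_impl_of_iff h (hφ j hj)).1 (hall _ ⟨j, hj, rfl⟩)
  · rintro hall _ ⟨j, hj, rfl⟩
    exact (fomSat_impl_of_iff h (hφ j hj)).2 (hall j hj)

end TimeSet

/-- Correspondence for arbitrary terms denoting a time point of the trace; the here-component is
generalized so that the induction also covers the total trace. -/
theorem sat_iff_fomSat_tr {A : Type} {T : ℕ → Set A} {τ : ℕ → ℕ} {len : ℕ∞}
    (hstrict : isStrict τ len) (φ : MForm A) {H : ℕ → Set A}
    (hHT : factSet H τ len ⊆ factSet T τ len) {i : ℕ} (hi : (i : ℕ∞) < len)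
    {t : FTerm} {ρ : ℕ → ℕ} (ht : t.val ρ = τ i) :
    sat φ H T τ len i ↔
      fomSat (tr φ t) (timeSet τ len) (factSet H τ len) (factSet T τ len) ρ := by
  induction φ generalizing H i t ρ with
  | bot => rfl
  | atom p =>
    refine ⟨fun h => ⟨i, hi, ht, h⟩, ?_⟩
    rintro ⟨j, hj, hij, h⟩
    rwa [(hstrict.eq_iff_eq hi hj).1 (ht.symm.trans hij)]
  | conj φ ψ ihφ ihψ => exact and_congr (ihφ hHT hi ht) (ihψ hHT hi ht)
  | disj φ ψ ihφ ihψ => exact or_congr (ihφ hHT hi ht) (ihψ hHT hi ht)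
  | impl φ ψ ihφ ihψ =>
    exact and_congr (or_congr (not_congr (ihφ hHT hi ht)) (ihψ hHT hi ht))
      (or_congr (not_congr (ihφ subset_rfl hi ht)) (ihψ subset_rfl hi ht))
  | prev m n φ ih =>
    have hgap {j : ℕ} (hj : (j : ℕ∞) < len) (X : Set (A × ℕ)) :
        fomSat (.ex (.conj (fomLt (.var 1) (.var 0)) (fomLt (.var 0) t.lift.lift)))
          (timeSet τ len) X (factSet T τ len) (consEnv (τ j) ρ) ↔
          ∃ l : ℕ, (l : ℕ∞) < len ∧ j < l ∧ l < i := by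
      rw [fomSat_ex_timeSet]
      refine exists_congr fun l => and_congr_right fun hl => ?_
      simp only [fomSat_conj, fomSat_fomLt, FTerm.val_lift_consEnv, FTerm.val_var, consEnv, ht,
        hstrict.lt_iff_lt hj hl, hstrict.lt_iff_lt hl hi]
    rw [tr, fomSat_ex_timeSet]
    constructor
    · rintro ⟨hk, hs, hI⟩
      have hj : ((i - 1 : ℕ) : ℕ∞) < len := natCast_lt_of_le_of_lt (Nat.sub_le i 1) hi
      have hlt := (hstrict.lt_iff_lt hj hi).2 (by omega)
      rw [inIntv_sub_iff hlt.le] at hI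
      refine ⟨i - 1, hj, ?_⟩
      simp only [fomSat_conj, fomSat_fomNeg_of_iff (hgap hj), fomSat_fomLt, fomSat_fomLeNeg,
        fomSat_fomPrec, FTerm.val_lift_consEnv, FTerm.val_var, consEnv, ht]
      refine ⟨hlt, ?_, hI.2, hI.1, (ih hHT hj rfl).1 hs⟩
      rintro ⟨l, -, h₁, h₂⟩
      omega
    · rintro ⟨j, hj, h⟩
      simp only [fomSat_conj, fomSat_fomNeg_of_iff (hgap hj), fomSat_fomLt, fomSat_fomLeNeg,
        fomSat_fomPrec, FTerm.val_lift_consEnv, FTerm.val_var, consEnv, ht] at h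
      obtain ⟨hlt, hempty, h₂, h₁, hs⟩ := h
      have hij := (hstrict.lt_iff_lt hj hi).1 hlt
      obtain rfl : j = i - 1 := by
        by_contra hne
        exact hempty ⟨i - 1, natCast_lt_of_le_of_lt (by omega) hi, by omega, by omega⟩
      exact ⟨by omega, (ih hHT hj rfl).2 hs, (inIntv_sub_iff hlt.le).2 ⟨h₁, h₂⟩⟩
  | next m n φ ih =>
    have hgap {j : ℕ} (hj : (j : ℕ∞) < len) (X : Set (A × ℕ)) :
        fomSat (.ex (.conj (fomLt t.lift.lift (.var 0)) (fomLt (.var 0) (.var 1))))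
          (timeSet τ len) X (factSet T τ len) (consEnv (τ j) ρ) ↔
          ∃ l : ℕ, (l : ℕ∞) < len ∧ i < l ∧ l < j := by
      rw [fomSat_ex_timeSet]
      refine exists_congr fun l => and_congr_right fun hl => ?_
      simp only [fomSat_conj, fomSat_fomLt, FTerm.val_lift_consEnv, FTerm.val_var, consEnv, ht,
        hstrict.lt_iff_lt hi hl, hstrict.lt_iff_lt hl hj]
    rw [tr, fomSat_ex_timeSet]
    constructor
    · rintro ⟨hk, hs, hI⟩
      have hj : ((i + 1 : ℕ) : ℕ∞) < len := by exact_mod_cast hk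
      have hlt := (hstrict.lt_iff_lt hi hj).2 (by omega)
      rw [inIntv_sub_iff hlt.le] at hI
      refine ⟨i + 1, hj, ?_⟩
      simp only [fomSat_conj, fomSat_fomNeg_of_iff (hgap hj), fomSat_fomLt, fomSat_fomLeNeg,
        fomSat_fomPrec, FTerm.val_lift_consEnv, FTerm.val_var, consEnv, ht]
      refine ⟨hlt, ?_, hI.1, hI.2, (ih hHT hj rfl).1 hs⟩
      rintro ⟨l, -, h₁, h₂⟩
      omega
    · rintro ⟨j, hj, h⟩
      simp only [fomSat_conj, fomSat_fomNeg_of_iff (hgap hj), fomSat_fomLt, fomSat_fomLeNeg,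
        fomSat_fomPrec, FTerm.val_lift_consEnv, FTerm.val_var, consEnv, ht] at h
      obtain ⟨hlt, hempty, h₁, h₂, hs⟩ := h
      have hij := (hstrict.lt_iff_lt hi hj).1 hlt
      obtain rfl : j = i + 1 := by
        by_contra hne
        exact hempty ⟨i + 1, natCast_lt_of_le_of_lt (by omega) hj, by omega, by omega⟩
      exact ⟨by exact_mod_cast hj, (ih hHT hj rfl).2 hs, (inIntv_sub_iff hlt.le).2 ⟨h₁, h₂⟩⟩
  | since m n φ ψ ihφ ihψ =>
    have hall {j : ℕ} (hj : (j : ℕ∞) < len) :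
        fomSat (.all (.impl (.conj (fomLt (.var 1) (.var 0)) (fomLe (.var 0) t.lift.lift))
          (tr φ (.var 0)))) (timeSet τ len) (factSet H τ len) (factSet T τ len) (consEnv (τ j) ρ) ↔
          ∀ l : ℕ, (l : ℕ∞) < len → j < l ∧ l ≤ i → sat φ H T τ len l := by
      rw [fomSat_all_impl_timeSet (p := fun l => j < l ∧ l ≤ i) hHT]
      · exact forall₂_congr fun l hl => imp_congr_right fun _ => (ihφ hHT hl rfl).symm
      · intro l hl X
        simp only [fomSat_conj, fomSat_fomLe, fomSat_fomLt, FTerm.val_lift_consEnv,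
          FTerm.val_var, consEnv, ht, hstrict.lt_iff_lt hj hl, hstrict.le_iff_le hl hi]
    rw [tr, fomSat_ex_timeSet]
    constructor
    · rintro ⟨j, hij, hI, hs, hφ⟩
      have hj := natCast_lt_of_le_of_lt hij hi
      have hle := (hstrict.le_iff_le hj hi).2 hij
      rw [inIntv_sub_iff hle] at hI
      refine ⟨j, hj, ?_⟩
      simp only [fomSat_conj, hall hj, fomSat_fomLe, fomSat_fomLeNeg, fomSat_fomPrec,
        FTerm.val_lift_consEnv, FTerm.val_var, consEnv, ht]
      exact ⟨hle, hI.2, hI.1, (ihψ hHT hj rfl).1 hs, fun l _ hl => hφ l hl.1 hl.2⟩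
    · rintro ⟨j, hj, h⟩
      simp only [fomSat_conj, hall hj, fomSat_fomLe, fomSat_fomLeNeg, fomSat_fomPrec,
        FTerm.val_lift_consEnv, FTerm.val_var, consEnv, ht] at h
      obtain ⟨hle, h₂, h₁, hs, hφ⟩ := h
      exact ⟨j, (hstrict.le_iff_le hj hi).1 hle, (inIntv_sub_iff hle).2 ⟨h₁, h₂⟩,
        (ihψ hHT hj rfl).2 hs,
        fun l h₁ h₂ => hφ l (natCast_lt_of_le_of_lt h₂ hi) ⟨h₁, h₂⟩⟩
  | untl m n φ ψ ihφ ihψ =>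
    have hall {j : ℕ} (hj : (j : ℕ∞) < len) :
        fomSat (.all (.impl (.conj (fomLe t.lift.lift (.var 0)) (fomLt (.var 0) (.var 1)))
          (tr φ (.var 0)))) (timeSet τ len) (factSet H τ len) (factSet T τ len) (consEnv (τ j) ρ) ↔
          ∀ l : ℕ, (l : ℕ∞) < len → i ≤ l ∧ l < j → sat φ H T τ len l := by
      rw [fomSat_all_impl_timeSet (p := fun l => i ≤ l ∧ l < j) hHT]
      · exact forall₂_congr fun l hl => imp_congr_right fun _ => (ihφ hHT hl rfl).symm
      · intro l hl X
        simp only [fomSat_conj, fomSat_fomLe, fomSat_fomLt, FTerm.val_lift_consEnv,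
          FTerm.val_var, consEnv, ht, hstrict.le_iff_le hi hl, hstrict.lt_iff_lt hl hj]
    rw [tr, fomSat_ex_timeSet]
    constructor
    · rintro ⟨j, hij, hj, hI, hs, hφ⟩
      have hle := (hstrict.le_iff_le hi hj).2 hij
      rw [inIntv_sub_iff hle] at hI
      refine ⟨j, hj, ?_⟩
      simp only [fomSat_conj, hall hj, fomSat_fomLe, fomSat_fomLeNeg, fomSat_fomPrec,
        FTerm.val_lift_consEnv, FTerm.val_var, consEnv, ht]
      exact ⟨hle, hI.1, hI.2, (ihψ hHT hj rfl).1 hs, fun l _ hl => hφ l hl.1 hl.2⟩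
    · rintro ⟨j, hj, h⟩
      simp only [fomSat_conj, hall hj, fomSat_fomLe, fomSat_fomLeNeg, fomSat_fomPrec,
        FTerm.val_lift_consEnv, FTerm.val_var, consEnv, ht] at h
      obtain ⟨hle, h₁, h₂, hs, hφ⟩ := h
      exact ⟨j, (hstrict.le_iff_le hi hj).1 hle, hj, (inIntv_sub_iff hle).2 ⟨h₁, h₂⟩,
        (ihψ hHT hj rfl).2 hs,
        fun l h₁ h₂ => hφ l (natCast_lt_of_le_of_lt h₂.le hj) ⟨h₁, h₂⟩⟩
  | trig m n φ ψ ihφ ihψ =>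
    have hex {j : ℕ} (hj : (j : ℕ∞) < len) :
        fomSat (.ex (.conj (fomLt (.var 1) (.var 0)) (.conj (fomLe (.var 0) t.lift.lift)
          (tr φ (.var 0))))) (timeSet τ len) (factSet H τ len) (factSet T τ len) (consEnv (τ j) ρ) ↔
          ∃ l : ℕ, j < l ∧ l ≤ i ∧ sat φ H T τ len l := by
      rw [fomSat_ex_timeSet]
      refine exists_congr fun l => ⟨fun ⟨hl, h⟩ => ?_, fun h => ?_⟩
      · simpa only [fomSat_conj, fomSat_fomLe, fomSat_fomLt, FTerm.val_lift_consEnv,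
          FTerm.val_var, consEnv, ht, hstrict.lt_iff_lt hj hl, hstrict.le_iff_le hl hi,
          ← ihφ hHT hl (t := .var 0) (ρ := consEnv (τ l) (consEnv (τ j) ρ)) rfl] using h
      · have hl := natCast_lt_of_le_of_lt h.2.1 hi
        refine ⟨hl, ?_⟩
        simpa only [fomSat_conj, fomSat_fomLe, fomSat_fomLt, FTerm.val_lift_consEnv,
          FTerm.val_var, consEnv, ht, hstrict.lt_iff_lt hj hl, hstrict.le_iff_le hl hi,
          ← ihφ hHT hl (t := .var 0) (ρ := consEnv (τ l) (consEnv (τ j) ρ)) rfl] using h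
    rw [tr, fomSat_all_impl_timeSet (p := fun j => j ≤ i ∧ inIntv m n (τ i - τ j)) hHT]
    · simp only [sat]
      refine forall_congr' fun j => ?_
      constructor
      · rintro h hj ⟨hij, hI⟩
        exact (or_congr (ihψ hHT hj rfl) (hex hj).symm).1 (h hij hI)
      · intro h hij hI
        have hj := natCast_lt_of_le_of_lt hij hi
        exact (or_congr (ihψ hHT hj rfl) (hex hj).symm).2 (h hj ⟨hij, hI⟩)
    · intro j hj X
      simp only [fomSat_conj, fomSat_fomLe, fomSat_fomLeNeg, fomSat_fomPrec,
        FTerm.val_lift_consEnv, FTerm.val_var, consEnv, ht, hstrict.le_iff_le hj hi]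
      refine and_congr_right fun hij => ?_
      rw [inIntv_sub_iff ((hstrict.le_iff_le hj hi).2 hij), and_comm]
  | rel m n φ ψ ihφ ihψ =>
    have hex {j : ℕ} (hj : (j : ℕ∞) < len) :
        fomSat (.ex (.conj (fomLe t.lift.lift (.var 0)) (.conj (fomLt (.var 0) (.var 1))
          (tr φ (.var 0))))) (timeSet τ len) (factSet H τ len) (factSet T τ len) (consEnv (τ j) ρ) ↔
          ∃ l : ℕ, i ≤ l ∧ l < j ∧ sat φ H T τ len l := by
      rw [fomSat_ex_timeSet]
      refine exists_congr fun l => ⟨fun ⟨hl, h⟩ => ?_, fun h => ?_⟩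
      · simpa only [fomSat_conj, fomSat_fomLe, fomSat_fomLt, FTerm.val_lift_consEnv,
          FTerm.val_var, consEnv, ht, hstrict.le_iff_le hi hl, hstrict.lt_iff_lt hl hj,
          ← ihφ hHT hl (t := .var 0) (ρ := consEnv (τ l) (consEnv (τ j) ρ)) rfl] using h
      · have hl := natCast_lt_of_le_of_lt h.2.1.le hj
        refine ⟨hl, ?_⟩
        simpa only [fomSat_conj, fomSat_fomLe, fomSat_fomLt, FTerm.val_lift_consEnv,
          FTerm.val_var, consEnv, ht, hstrict.le_iff_le hi hl, hstrict.lt_iff_lt hl hj,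
          ← ihφ hHT hl (t := .var 0) (ρ := consEnv (τ l) (consEnv (τ j) ρ)) rfl] using h
    rw [tr, fomSat_all_impl_timeSet (p := fun j => i ≤ j ∧ inIntv m n (τ j - τ i)) hHT]
    · simp only [sat]
      refine forall_congr' fun j => ?_
      constructor
      · rintro h hj ⟨hij, hI⟩
        exact (or_congr (ihψ hHT hj rfl) (hex hj).symm).1 (h hij hj hI)
      · intro h hij hj hI
        exact (or_congr (ihψ hHT hj rfl) (hex hj).symm).2 (h hj ⟨hij, hI⟩)
    · intro j hj X
      simp only [fomSat_conj, fomSat_fomLe, fomSat_fomLeNeg, fomSat_fomPrec,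
        FTerm.val_lift_consEnv, FTerm.val_var, consEnv, ht, hstrict.le_iff_le hi hj]
      refine and_congr_right fun hij => ?_
      rw [inIntv_sub_iff ((hstrict.le_iff_le hi hj).2 hij)]

/-- Model correspondence for the first-order translation (Theorem 5). -/
theorem kamp_correspondence {A : Type} (φ : MForm A) (hφ : goodIntervals φ)
    (H T : ℕ → Set A) (τ : ℕ → ℕ) (len : ℕ∞) (hlen : 0 < len)
    (htrace : isTrace H T τ len) (hstrict : isStrict τ len)
    (i : ℕ) (hi : (i : ℕ∞) < len) :
    (sat φ H T τ len i ↔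
      fomSat (tr φ (FTerm.const (τ i)))
        {d | ∃ j : ℕ, (j : ℕ∞) < len ∧ τ j = d}
        {q | ∃ j : ℕ, (j : ℕ∞) < len ∧ q.2 = τ j ∧ q.1 ∈ H j}
        {q | ∃ j : ℕ, (j : ℕ∞) < len ∧ q.2 = τ j ∧ q.1 ∈ T j}
        (fun _ => 0)) ∧
    (sat φ T T τ len i ↔
      fomSat (tr φ (FTerm.const (τ i)))
        {d | ∃ j : ℕ, (j : ℕ∞) < len ∧ τ j = d}
        {q | ∃ j : ℕ, (j : ℕ∞) < len ∧ q.2 = τ j ∧ q.1 ∈ T j}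
        {q | ∃ j : ℕ, (j : ℕ∞) < len ∧ q.2 = τ j ∧ q.1 ∈ T j}
        (fun _ => 0)) :=
  ⟨sat_iff_fomSat_tr hstrict φ (factSet_mono htrace.1) hi rfl,
    sat_iff_fomSat_tr hstrict φ subset_rfl hi rfl⟩
end
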